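/- arXiv:1604.04084 — 4 statements merged into one kernel-verified Lean document; each statement's English description precedes it below -/
import Mathlib

section
/- The set of conjugates of T by elements of the subgroup ⟨X, Y⟩ of Equiv.Perm (Fin 22), namely {g⁻¹ T g : g ∈ ⟨X, Y⟩}, has exactly 14 elements. -/
namespace M22Perm

/-- the cycle `(a₁ a₂ … a_k)` as a permutation of `Fin 22`; the points are
labelled `1, …, 22`, with point `22` represented by `(22 : Fin 22) = 0`. -/
def cyc (l : List (Fin 22)) : Equiv.Perm (Fin 22) := l.formPerm

/-- `T = (2,10)(3,11)(4,19)(5,22)(6,18)(7,14)(9,15)(12,13)` -/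
def T : Equiv.Perm (Fin 22) :=
  cyc [2, 10] * cyc [3, 11] * cyc [4, 19] * cyc [5, 22] * cyc [6, 18] *
    cyc [7, 14] * cyc [9, 15] * cyc [12, 13]

/-- `X = (1,12,14,10,8,17,15)(2,18,22,13,3,7,9)(5,6,19,21,20,11,16)` -/
def X : Equiv.Perm (Fin 22) :=
  cyc [1, 12, 14, 10, 8, 17, 15] * cyc [2, 18, 22, 13, 3, 7, 9] *
    cyc [5, 6, 19, 21, 20, 11, 16]

/-- `Y = (2,9)(3,4)(5,6)(7,13)(10,15)(11,19)(12,14)(18,22)` -/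
def Y : Equiv.Perm (Fin 22) :=
  cyc [2, 9] * cyc [3, 4] * cyc [5, 6] * cyc [7, 13] * cyc [10, 15] *
    cyc [11, 19] * cyc [12, 14] * cyc [18, 22]

/-- Value table of `X`. -/
def tabX : Fin 22 → Fin 22 := ![13, 12, 18, 7, 4, 6, 19, 9, 17, 2, 8, 16, 14, 3, 10, 1, 5, 15, 0, 21, 11, 20]

/-- Value table of `Y`. -/
def tabY : Fin 22 → Fin 22 := ![18, 1, 9, 4, 3, 6, 5, 13, 8, 2, 15, 19, 14, 7, 12, 10, 16, 17, 0, 11, 20, 21]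

/-- Value tables of the fourteen conjugates. -/
def tabQ : Fin 14 → Fin 22 → Fin 22 := ![
  ![5, 1, 10, 11, 19, 0, 18, 14, 8, 15, 2, 3, 13, 12, 7, 9, 16, 17, 6, 4, 20, 21],
  ![1, 0, 5, 12, 6, 2, 4, 17, 8, 14, 10, 11, 3, 20, 9, 15, 18, 7, 16, 19, 13, 21],
  ![21, 13, 11, 8, 5, 4, 6, 12, 3, 16, 10, 2, 7, 1, 14, 18, 9, 17, 15, 19, 20, 0],
  ![16, 18, 12, 5, 14, 3, 9, 20, 8, 6, 10, 11, 2, 17, 4, 15, 0, 13, 1, 19, 7, 21],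
  ![15, 3, 17, 1, 16, 5, 6, 11, 8, 20, 13, 7, 12, 10, 14, 0, 4, 2, 19, 18, 9, 21],
  ![10, 7, 16, 6, 8, 5, 3, 1, 4, 19, 0, 11, 12, 14, 13, 15, 2, 17, 21, 9, 20, 18],
  ![8, 9, 15, 21, 12, 7, 6, 5, 0, 1, 10, 18, 4, 16, 14, 2, 13, 17, 11, 19, 20, 3],
  ![14, 1, 6, 20, 11, 5, 2, 21, 9, 8, 10, 4, 12, 15, 0, 13, 16, 18, 17, 19, 3, 7],
  ![11, 4, 20, 16, 1, 5, 6, 15, 8, 17, 18, 0, 12, 19, 14, 7, 3, 9, 10, 13, 2, 21],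
  ![12, 1, 19, 15, 10, 13, 7, 6, 8, 11, 4, 9, 0, 5, 18, 3, 16, 17, 14, 2, 20, 21],
  ![19, 2, 1, 14, 21, 5, 13, 16, 18, 10, 9, 11, 12, 6, 3, 15, 7, 17, 8, 0, 20, 4],
  ![17, 1, 8, 19, 20, 9, 6, 10, 2, 5, 7, 11, 18, 21, 14, 15, 16, 0, 12, 3, 4, 13],
  ![6, 1, 14, 17, 15, 5, 0, 8, 7, 21, 10, 13, 12, 11, 2, 4, 16, 3, 20, 19, 18, 9],
  ![20, 1, 21, 10, 17, 18, 6, 19, 13, 12, 3, 11, 9, 8, 14, 15, 16, 4, 5, 7, 0, 2]]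

/-- The action of `X` on the indices of the conjugates. -/
def sX : Fin 14 → Fin 14 := ![1, 2, 4, 6, 7, 9, 8, 11, 12, 3, 0, 10, 13, 5]

/-- The action of `Y` on the indices of the conjugates. -/
def sY : Fin 14 → Fin 14 := ![0, 3, 5, 1, 8, 2, 10, 11, 4, 9, 6, 7, 13, 12]

theorem tabQ_invol : ∀ i x, tabQ i (tabQ i x) = x := by decide +kernel

/-- The fourteen conjugates (all involutions). -/
def Q (i : Fin 14) : Equiv.Perm (Fin 22) :=
  ⟨tabQ i, tabQ i, tabQ_invol i, tabQ_invol i⟩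

theorem X_apply : ∀ x, X x = tabX x := by decide +kernel
theorem Y_apply : ∀ x, Y x = tabY x := by decide +kernel
theorem T_apply : ∀ x, T x = tabQ 0 x := by decide +kernel

theorem T_eq : T = Q 0 := Equiv.ext T_apply

theorem tabX_conj : ∀ i x, tabQ i (tabX x) = tabX (tabQ (sX i) x) := by decide +kernel
theorem tabY_conj : ∀ i x, tabQ i (tabY x) = tabY (tabQ (sY i) x) := by decide +kernel

theorem X_conj (i : Fin 14) : X⁻¹ * Q i * X = Q (sX i) := by
  rw [mul_assoc, inv_mul_eq_iff_eq_mul]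
  ext1 x
  simp only [Equiv.Perm.mul_apply, X_apply]
  exact tabX_conj i x

theorem Y_conj (i : Fin 14) : Y⁻¹ * Q i * Y = Q (sY i) := by
  rw [mul_assoc, inv_mul_eq_iff_eq_mul]
  ext1 x
  simp only [Equiv.Perm.mul_apply, Y_apply]
  exact tabY_conj i x

theorem Q_injective : Function.Injective Q := by
  have h : ∀ i j, (∀ x, tabQ i x = tabQ j x) → i = j := by decide +kernel
  intro i j hij
  exact h i j fun x => congrArg (fun p : Equiv.Perm (Fin 22) => p x) hij

theorem closure_conj (g : Equiv.Perm (Fin 22)) (hg : g ∈ Subgroup.closure {X, Y}) :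
    ∃ e : Equiv.Perm (Fin 14), ∀ i, g⁻¹ * Q i * g = Q (e i) := by
  induction hg using Subgroup.closure_induction with
  | mem x hx =>
    rcases hx with rfl | rfl
    · exact ⟨Equiv.ofBijective sX (by decide +kernel), X_conj⟩
    · exact ⟨Equiv.ofBijective sY (by decide +kernel), Y_conj⟩
  | one => exact ⟨1, fun i => by simp⟩
  | mul x y _ _ hx hy =>
    obtain ⟨e, he⟩ := hx
    obtain ⟨f, hf⟩ := hy
    refine ⟨f * e, fun i => ?_⟩
    rw [Equiv.Perm.mul_apply, ← hf, ← he]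
    group
  | inv x _ hx =>
    obtain ⟨e, he⟩ := hx
    refine ⟨e.symm, fun i => ?_⟩
    have h := he (e.symm i)
    rw [Equiv.apply_symm_apply] at h
    rw [← h]
    group

/-- Being a conjugate of `T` under the group. -/
def Reach (i : Fin 14) : Prop := ∃ g ∈ Subgroup.closure {X, Y}, Q i = g⁻¹ * T * g

theorem Reach.stepX {i : Fin 14} (h : Reach i) : Reach (sX i) := by
  obtain ⟨g, hg, h⟩ := h
  refine ⟨g * X, mul_mem hg (Subgroup.subset_closure (by simp)), ?_⟩
  rw [← X_conj, h]
  group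

theorem Reach.stepY {i : Fin 14} (h : Reach i) : Reach (sY i) := by
  obtain ⟨g, hg, h⟩ := h
  refine ⟨g * Y, mul_mem hg (Subgroup.subset_closure (by simp)), ?_⟩
  rw [← Y_conj, h]
  group

theorem reach_all (i : Fin 14) : Reach i := by
  have h0 : Reach 0 := ⟨1, one_mem _, by simp [T_eq]⟩
  have h1 : Reach 1 := h0.stepX
  have h2 : Reach 2 := h1.stepX
  have h3 : Reach 3 := h1.stepY
  have h4 : Reach 4 := h2.stepX
  have h5 : Reach 5 := h2.stepY
  have h6 : Reach 6 := h3.stepX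
  have h7 : Reach 7 := h4.stepX
  have h8 : Reach 8 := h4.stepY
  have h9 : Reach 9 := h5.stepX
  have h10 : Reach 10 := h6.stepY
  have h11 : Reach 11 := h7.stepX
  have h12 : Reach 12 := h8.stepX
  have h13 : Reach 13 := h12.stepX
  fin_cases i
  exacts [h0, h1, h2, h3, h4, h5, h6, h7, h8, h9, h10, h11, h12, h13]

/-- The set of conjugates of `T` by elements of `⟨X, Y⟩` has exactly `14`
elements. -/
theorem ncard_conjugates :
    Set.ncard {p : Equiv.Perm (Fin 22) |
      ∃ g ∈ Subgroup.closure {X, Y}, p = g⁻¹ * T * g} = 14 := by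
  have hset : {p : Equiv.Perm (Fin 22) |
      ∃ g ∈ Subgroup.closure {X, Y}, p = g⁻¹ * T * g} = Set.range Q := by
    ext p
    constructor
    · rintro ⟨g, hg, rfl⟩
      obtain ⟨e, he⟩ := closure_conj g hg
      exact ⟨e 0, by rw [T_eq, he]⟩
    · rintro ⟨i, rfl⟩
      exact reach_all i
  rw [hset, Set.ncard_range_of_injective Q_injective]
  simp

end M22Perm
end

section
/- The subgroup of Equiv.Perm (Fin 22) generated by the set of conjugates {g⁻¹ T g : g ∈ ⟨X, Y⟩} equals the subgroup ⟨X, Y, T⟩, and this subgroup has order 443520 (it is the Mathieu group M_22). -/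
namespace M22Perm

/-- Table of values of a permutation. -/
def enc (g : Equiv.Perm (Fin 22)) : List ℕ := List.ofFn fun i => (g i).val

/-- The table of the identity. -/
def idT : List ℕ := List.range 22

/-- Product of tables. -/
def mulT (s t : List ℕ) : List ℕ := t.map fun i => s.getD i 0

/-- Inverse of a table. -/
def invT (t : List ℕ) : List ℕ := (List.range 22).map fun i => t.idxOf i

theorem enc_inj {g h : Equiv.Perm (Fin 22)} (e : enc g = enc h) : g = h := by
  have := List.ofFn_injective e
  ext i
  exact congrFun this i

theorem enc_one : enc 1 = idT := by decide +kernel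

theorem enc_getD (g : Equiv.Perm (Fin 22)) (i : Fin 22) : (enc g).getD i 0 = (g i).val := by
  rw [List.getD_eq_getElem _ _ (by rw [enc, List.length_ofFn]; exact i.isLt)]
  simp only [enc, List.getElem_ofFn]

theorem enc_mul (g h : Equiv.Perm (Fin 22)) : enc (g * h) = mulT (enc g) (enc h) := by
  unfold mulT
  conv_rhs => rw [show enc h = List.ofFn fun i => (h i).val from rfl]
  rw [List.map_ofFn]
  unfold enc
  congr 1
  funext i
  exact (enc_getD g (h i)).symm

theorem idxOf_enc (g : Equiv.Perm (Fin 22)) (i : Fin 22) :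
    (enc g).idxOf (g i).val = i.val := by
  have nd : (enc g).Nodup := by
    unfold enc
    rw [List.nodup_ofFn]
    intro a b hab
    exact g.injective (Fin.ext hab)
  have hl : i.val < (enc g).length := by simp [enc]
  have := nd.idxOf_getElem i.val hl
  rw [show (enc g)[i.val] = (g i).val by simp only [enc, List.getElem_ofFn]] at this
  exact this

theorem enc_inv (g : Equiv.Perm (Fin 22)) : enc g⁻¹ = invT (enc g) := by
  apply List.ext_getElem
  · simp [enc, invT]
  · intro i h1 h2
    have hi : i < 22 := by simpa [enc] using h1
    have := idxOf_enc g (g⁻¹ ⟨i, hi⟩)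
    rw [show g (g⁻¹ ⟨i, hi⟩) = ⟨i, hi⟩ from Equiv.apply_symm_apply g _] at this
    change (enc g).idxOf i = _ at this
    simp only [invT, List.getElem_map, List.getElem_range]
    rw [this]
    simp only [enc, List.getElem_ofFn]

/-- Value of a word in a list of permutations. -/
def evW (gs : List (Equiv.Perm (Fin 22))) (w : List ℕ) : Equiv.Perm (Fin 22) :=
  w.foldr (fun k r => gs.getD k 1 * r) 1

/-- Value of a word in a list of tables. -/
def evT (gs : List (List ℕ)) (w : List ℕ) : List ℕ :=
  w.foldr (fun k r => mulT (gs.getD k idT) r) idT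

theorem enc_evW (gs : List (Equiv.Perm (Fin 22))) (w : List ℕ) :
    enc (evW gs w) = evT (gs.map enc) w := by
  induction w with
  | nil => exact enc_one
  | cons k w ih =>
    change enc (gs.getD k 1 * evW gs w) = mulT ((gs.map enc).getD k idT) (evT (gs.map enc) w)
    rw [enc_mul, ih, ← enc_one, List.getD_map]

theorem map_enc_evW (gs : List (Equiv.Perm (Fin 22))) (ws : List (List ℕ)) :
    (ws.map (evW gs)).map enc = ws.map (evT (gs.map enc)) := by
  rw [List.map_map]
  exact List.map_congr_left fun w _ => enc_evW gs w

theorem evW_mem (gs : List (Equiv.Perm (Fin 22))) (w : List ℕ) :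
    evW gs w ∈ Subgroup.closure {x | x ∈ gs} := by
  induction w with
  | nil => exact one_mem _
  | cons k w ih =>
    refine mul_mem ?_ ih
    rw [List.getD_eq_getElem?_getD]
    rcases h : gs[k]? with _ | x
    · exact one_mem _
    · exact Subgroup.subset_closure (List.mem_of_getElem? h)

/-- Sifting of a table through a list of transversals. -/
def sift : List (ℕ × List (List ℕ)) → List ℕ → Bool
  | [], r => r == idT
  | p :: L, r => p.2.any fun u => u.getD p.1 0 == r.getD p.1 0 && sift L (mulT (invT u) r)

theorem sift_nil (g : Equiv.Perm (Fin 22)) (h : sift [] (enc g) = true) :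
    g ∈ Subgroup.closure {x | x ∈ ([] : List (Equiv.Perm (Fin 22)))} := by
  have h1 : enc g = idT := by simpa [sift] using h
  rw [← enc_one] at h1
  rw [enc_inj h1]
  exact one_mem _

/-- The orbit-stabilizer step. -/
theorem step (H : Subgroup (Equiv.Perm (Fin 22))) (S : Set (Equiv.Perm (Fin 22)))
    (U : List (Equiv.Perm (Fin 22))) (b : Fin 22) (h1 : 1 ∈ U)
    (hSU : ∀ u ∈ U, ∀ s ∈ S, ∃ v ∈ U, v⁻¹ * (s * u) ∈ H)
    (hH : H ≤ Subgroup.closure S) (hU : ∀ u ∈ U, u ∈ Subgroup.closure S)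
    (hfix : ∀ h ∈ H, h b = b) (nd : (U.map fun u => u b).Nodup) :
    Nat.card (Subgroup.closure S) = U.length * Nat.card H := by
  have key : ∀ g ∈ Subgroup.closure S, ∃ v ∈ U, v⁻¹ * g ∈ H := by
    intro g hg
    have hg' : g ∈ Submonoid.closure S := by
      rw [← Subgroup.closure_toSubmonoid_of_finite]
      exact hg
    induction hg' using Submonoid.closure_induction_left with
    | one => exact ⟨1, h1, by simp⟩
    | mul_left s hs y hy ih =>
      have hy' : y ∈ Subgroup.closure S :=
        Submonoid.closure_le.mpr (Subgroup.subset_closure (k := S)) hy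
      obtain ⟨u, hu, hm⟩ := ih hy'
      obtain ⟨v, hv, hm2⟩ := hSU u hu s hs
      refine ⟨v, hv, ?_⟩
      have := mul_mem hm2 hm
      convert this using 1
      group
  have ndU : U.Nodup := List.Nodup.of_map _ nd
  have hinj : ∀ u ∈ U, ∀ v ∈ U, u b = v b → u = v :=
    fun u hu v hv e => List.inj_on_of_nodup_map nd hu hv e
  let f : {x // x ∈ U} × H → Subgroup.closure S :=
    fun p => ⟨p.1.1 * p.2.1, mul_mem (hU _ p.1.2) (hH p.2.2)⟩
  have hf : Function.Bijective f := by
    constructor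
    · rintro ⟨⟨u, hu⟩, ⟨h, hh⟩⟩ ⟨⟨v, hv⟩, ⟨k, hk⟩⟩ e
      have e' : u * h = v * k := congrArg Subtype.val e
      have eb : u b = v b := by
        have := congrArg (fun g : Equiv.Perm (Fin 22) => g b) e'
        simpa [Equiv.Perm.mul_apply, hfix h hh, hfix k hk] using this
      have := hinj u hu v hv eb
      subst this
      have := mul_left_cancel e'
      subst this
      rfl
    · rintro ⟨g, hg⟩
      obtain ⟨v, hv, hm⟩ := key g hg
      exact ⟨⟨⟨v, hv⟩, ⟨_, hm⟩⟩, Subtype.ext (by simp [f])⟩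
  rw [← Nat.card_congr (Equiv.ofBijective f hf), Nat.card_prod]
  congr 1
  rw [← List.toFinset_card_of_nodup ndU, Nat.subtype_card U.toFinset (fun x => List.mem_toFinset)]

/-- One level of the stabilizer chain, verified on tables. -/
theorem level (S : List (Equiv.Perm (Fin 22))) (ST : List (List ℕ)) (hST : S.map enc = ST)
    (ws : List (List ℕ)) (UT : List (List ℕ)) (hUT : ws.map (evT ST) = UT) (b : Fin 22)
    (ws' : List (List ℕ)) (S' : List (Equiv.Perm (Fin 22))) (hS' : S' = ws'.map (evW S))
    (ST' : List (List ℕ)) (hST' : S'.map enc = ST')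
    (L : List (ℕ × List (List ℕ)))
    (hL : ∀ g, sift L (enc g) = true → g ∈ Subgroup.closure {x | x ∈ S'})
    (hfix : ∀ s ∈ ST', s.getD b 0 = b.val) (hnil : [] ∈ ws)
    (chk : (UT.all fun u => ST.all fun s => sift ((b.val, UT) :: L) (mulT s u)) = true)
    (nd : (UT.map fun u => u.getD b 0).Nodup) :
    Nat.card (Subgroup.closure {x | x ∈ S}) =
        UT.length * Nat.card (Subgroup.closure {x | x ∈ S'}) ∧
      ∀ g, sift ((b.val, UT) :: L) (enc g) = true → g ∈ Subgroup.closure {x | x ∈ S} := by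
  subst hST hST'
  have hU : UT = (ws.map (evW S)).map enc := by rw [map_enc_evW, hUT]
  have hle : Subgroup.closure {x | x ∈ S'} ≤ Subgroup.closure {x | x ∈ S} := by
    rw [Subgroup.closure_le]
    intro x hx
    have hx' : x ∈ S' := hx
    rw [hS', List.mem_map] at hx'
    obtain ⟨w, _, rfl⟩ := hx'
    exact evW_mem S w
  have hUm : ∀ u ∈ ws.map (evW S), u ∈ Subgroup.closure {x | x ∈ S} := by
    intro u hu
    rw [List.mem_map] at hu
    obtain ⟨w, _, rfl⟩ := hu
    exact evW_mem S w
  have hs : ∀ g, sift ((b.val, UT) :: L) (enc g) = true →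
      ∃ v ∈ ws.map (evW S), v⁻¹ * g ∈ Subgroup.closure {x | x ∈ S'} := by
    intro g hg
    rw [sift, List.any_eq_true] at hg
    obtain ⟨t, ht, h2⟩ := hg
    rw [Bool.and_eq_true] at h2
    have ht' : t ∈ UT := ht
    rw [hU, List.mem_map] at ht'
    obtain ⟨v, hv, rfl⟩ := ht'
    refine ⟨v, hv, hL _ ?_⟩
    rw [enc_mul, enc_inv]
    exact h2.2
  refine ⟨?_, ?_⟩
  · have hlen : UT.length = (ws.map (evW S)).length := by rw [hU, List.length_map]
    rw [hlen]
    refine step _ _ _ b ?_ ?_ hle hUm ?_ ?_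
    · exact List.mem_map.mpr ⟨[], hnil, rfl⟩
    · intro u hu s hsS
      apply hs
      rw [List.all_eq_true] at chk
      have c1 := chk (enc u) (by rw [hU]; exact List.mem_map_of_mem hu)
      rw [List.all_eq_true] at c1
      rw [enc_mul]
      exact c1 (enc s) (List.mem_map_of_mem hsS)
    · intro h hh
      have hc : Subgroup.closure {x | x ∈ S'} ≤ MulAction.stabilizer (Equiv.Perm (Fin 22)) b := by
        rw [Subgroup.closure_le]
        intro x hx
        have e := hfix (enc x) (List.mem_map_of_mem hx)
        rw [enc_getD] at e
        exact Fin.ext e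
      exact hc hh
    · have e : (UT.map fun u => u.getD b 0) =
          ((ws.map (evW S)).map fun u => u b).map Fin.val := by
        rw [hU]
        generalize ws.map (evW S) = U
        rw [List.map_map, List.map_map]
        exact List.map_congr_left fun u _ => enc_getD u b
      rw [e] at nd
      exact List.Nodup.of_map _ nd
  · intro g hg
    obtain ⟨v, hv, hm⟩ := hs g hg
    have := mul_mem (hUm v hv) (hle hm)
    simpa using this

/-- Tables of the generators at level 1. -/
def ST1 : List (List ℕ) := [
  [13, 12, 18, 7, 4, 6, 19, 9, 17, 2, 8, 16, 14, 3, 10, 1, 5, 15, 0, 21, 11, 20],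
  [18, 1, 9, 4, 3, 6, 5, 13, 8, 2, 15, 19, 14, 7, 12, 10, 16, 17, 0, 11, 20, 21],
  [5, 1, 10, 11, 19, 0, 18, 14, 8, 15, 2, 3, 13, 12, 7, 9, 16, 17, 6, 4, 20, 21]]

/-- Words for the transversal at level 1. -/
def W1 : List (List ℕ) := [[], [0], [0, 0], [2, 0], [0, 0, 0], [2, 0, 0], [0, 2, 0], [0, 0, 0, 0], [1, 0, 0, 0],
  [2, 0, 0, 0], [0, 2, 0, 0], [1, 0, 2, 0], [2, 0, 2, 0], [0, 0, 0, 0, 0], [0, 2, 0, 0, 0],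
  [2, 1, 0, 2, 0], [0, 2, 0, 2, 0], [0, 0, 2, 0, 0, 0], [2, 0, 2, 0, 0, 0],
  [0, 2, 1, 0, 2, 0], [0, 0, 2, 0, 2, 0],
  [0, 0, 2, 1, 0, 2, 0]]

/-- Tables of the transversal at level 1 (base point 1). -/
def UT1 : List (List ℕ) := [
  [0, 1, 2, 3, 4, 5, 6, 7, 8, 9, 10, 11, 12, 13, 14, 15, 16, 17, 18, 19, 20, 21],
  [13, 12, 18, 7, 4, 6, 19, 9, 17, 2, 8, 16, 14, 3, 10, 1, 5, 15, 0, 21, 11, 20],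
  [3, 14, 0, 9, 4, 19, 21, 2, 15, 18, 17, 5, 10, 7, 8, 12, 6, 1, 13, 20, 16, 11],
  [12, 13, 6, 14, 19, 18, 4, 15, 17, 10, 8, 16, 7, 11, 2, 1, 0, 9, 5, 21, 3, 20],
  [7, 10, 13, 2, 4, 21, 20, 18, 1, 0, 15, 6, 8, 9, 17, 14, 19, 12, 3, 11, 5, 16],
  [11, 7, 5, 15, 19, 4, 21, 10, 9, 6, 17, 0, 2, 14, 8, 13, 18, 1, 12, 20, 16, 3],
  [14, 3, 19, 10, 21, 0, 4, 1, 15, 8, 17, 5, 9, 16, 18, 12, 13, 2, 6, 20, 7, 11],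
  [9, 8, 3, 18, 4, 20, 11, 0, 12, 13, 1, 19, 17, 2, 15, 10, 21, 14, 7, 16, 6, 5],
  [13, 15, 7, 9, 3, 21, 20, 0, 1, 18, 10, 5, 8, 2, 17, 12, 11, 14, 4, 19, 6, 16],
  [14, 2, 12, 10, 19, 21, 20, 6, 1, 5, 9, 18, 8, 15, 17, 7, 4, 13, 11, 3, 0, 16],
  [16, 9, 6, 1, 21, 4, 20, 8, 2, 19, 15, 13, 18, 10, 17, 3, 0, 12, 14, 11, 5, 7],
  [12, 4, 11, 15, 21, 18, 3, 1, 10, 8, 17, 6, 2, 16, 0, 14, 7, 9, 5, 20, 13, 19],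
  [7, 11, 4, 2, 21, 5, 19, 1, 9, 8, 17, 0, 15, 16, 6, 13, 12, 10, 18, 20, 14, 3],
  [2, 17, 7, 0, 4, 11, 16, 13, 14, 3, 12, 21, 15, 18, 1, 8, 20, 10, 9, 5, 19, 6],
  [10, 18, 14, 8, 21, 20, 11, 19, 12, 6, 2, 0, 17, 1, 15, 9, 4, 3, 16, 7, 13, 5],
  [13, 19, 3, 9, 21, 6, 11, 1, 2, 8, 17, 18, 10, 16, 5, 7, 14, 15, 0, 20, 12, 4],
  [9, 16, 4, 18, 20, 6, 21, 12, 2, 17, 15, 13, 1, 5, 19, 3, 14, 8, 0, 11, 10, 7],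
  [8, 0, 10, 17, 20, 11, 16, 21, 14, 19, 18, 13, 15, 12, 1, 2, 4, 7, 5, 9, 3, 6],
  [2, 6, 7, 8, 21, 20, 3, 4, 13, 18, 10, 5, 17, 1, 9, 15, 19, 11, 16, 14, 12, 0],
  [3, 21, 7, 2, 20, 19, 16, 12, 18, 17, 15, 0, 8, 5, 6, 9, 10, 1, 13, 11, 14, 4],
  [2, 5, 4, 0, 11, 19, 20, 14, 18, 15, 1, 3, 12, 6, 21, 7, 10, 17, 13, 16, 8, 9],
  [7, 20, 9, 18, 11, 21, 5, 14, 0, 15, 1, 13, 17, 6, 19, 2, 8, 12, 3, 16, 10, 4]]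

/-- Tables of the generators at level 2. -/
def ST2 : List (List ℕ) := [
  [5, 1, 10, 11, 19, 0, 18, 14, 8, 15, 2, 3, 13, 12, 7, 9, 16, 17, 6, 4, 20, 21],
  [18, 1, 0, 9, 5, 14, 10, 17, 2, 12, 15, 13, 16, 20, 8, 3, 6, 19, 4, 11, 21, 7]]

/-- Words for the transversal at level 2. -/
def W2 : List (List ℕ) := [[], [0], [1], [1, 0], [0, 1], [1, 1], [0, 1, 0], [1, 1, 0], [1, 0, 1], [0, 1, 1],
  [1, 1, 1], [1, 0, 1, 0], [0, 1, 1, 0], [0, 1, 0, 1], [1, 1, 0, 1], [0, 1, 1, 1],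
  [0, 1, 0, 1, 0], [1, 1, 0, 1, 0], [1, 0, 1, 0, 1], [1, 0, 1, 0, 1, 0],
  [1, 1, 0, 1, 0, 1, 0]]

/-- Tables of the transversal at level 2 (base point 2). -/
def UT2 : List (List ℕ) := [
  [0, 1, 2, 3, 4, 5, 6, 7, 8, 9, 10, 11, 12, 13, 14, 15, 16, 17, 18, 19, 20, 21],
  [5, 1, 10, 11, 19, 0, 18, 14, 8, 15, 2, 3, 13, 12, 7, 9, 16, 17, 6, 4, 20, 21],
  [18, 1, 0, 9, 5, 14, 10, 17, 2, 12, 15, 13, 16, 20, 8, 3, 6, 19, 4, 11, 21, 7],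
  [14, 1, 15, 13, 11, 18, 4, 8, 2, 3, 0, 9, 20, 16, 17, 12, 6, 19, 10, 5, 21, 7],
  [6, 1, 5, 15, 0, 7, 2, 17, 10, 13, 9, 12, 16, 20, 8, 11, 18, 4, 19, 3, 21, 14],
  [4, 1, 18, 12, 14, 8, 15, 19, 0, 16, 3, 20, 6, 21, 2, 9, 10, 11, 5, 13, 7, 17],
  [7, 1, 9, 12, 3, 6, 19, 8, 10, 11, 5, 15, 20, 16, 17, 13, 18, 4, 2, 0, 21, 14],
  [8, 1, 3, 20, 13, 4, 5, 2, 0, 9, 18, 12, 21, 6, 19, 16, 10, 11, 15, 14, 7, 17],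
  [10, 1, 14, 3, 18, 17, 0, 19, 15, 20, 12, 16, 6, 21, 2, 13, 4, 5, 11, 9, 7, 8],
  [19, 1, 6, 13, 7, 8, 9, 4, 5, 16, 11, 20, 18, 21, 10, 15, 2, 3, 0, 12, 14, 17],
  [5, 1, 4, 16, 8, 2, 3, 11, 18, 6, 9, 21, 10, 7, 0, 12, 15, 13, 14, 20, 17, 19],
  [17, 1, 12, 16, 9, 10, 11, 2, 15, 13, 14, 3, 21, 6, 19, 20, 4, 5, 0, 18, 7, 8],
  [8, 1, 11, 20, 12, 19, 0, 10, 5, 15, 6, 13, 21, 18, 4, 16, 2, 3, 9, 7, 14, 17],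
  [2, 1, 7, 11, 6, 17, 5, 4, 9, 20, 13, 16, 18, 21, 10, 12, 19, 0, 3, 15, 14, 8],
  [15, 1, 8, 9, 4, 19, 18, 11, 3, 21, 16, 6, 10, 7, 0, 20, 5, 14, 13, 12, 17, 2],
  [0, 1, 19, 16, 8, 10, 11, 3, 6, 18, 15, 21, 2, 14, 5, 13, 9, 12, 7, 20, 17, 4],
  [17, 1, 13, 16, 15, 2, 3, 10, 9, 12, 7, 11, 21, 18, 4, 20, 19, 0, 5, 6, 14, 8],
  [19, 1, 16, 6, 12, 15, 13, 0, 3, 20, 8, 9, 7, 10, 11, 21, 5, 14, 18, 4, 17, 2],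
  [0, 1, 17, 13, 10, 19, 14, 5, 12, 21, 20, 6, 4, 7, 15, 16, 11, 18, 9, 3, 8, 2],
  [19, 1, 20, 6, 3, 0, 9, 15, 12, 16, 17, 13, 7, 4, 5, 21, 11, 18, 14, 10, 8, 2],
  [11, 1, 21, 10, 9, 18, 12, 3, 16, 6, 19, 20, 17, 5, 14, 7, 13, 4, 8, 15, 2, 0]]

/-- Tables of the generators at level 3. -/
def ST3 : List (List ℕ) := [
  [3, 1, 2, 12, 5, 11, 4, 13, 9, 7, 6, 10, 15, 17, 18, 21, 14, 8, 20, 16, 19, 0],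
  [3, 1, 2, 20, 17, 10, 13, 0, 7, 18, 12, 21, 19, 14, 9, 11, 5, 15, 6, 16, 8, 4]]

/-- Words for the transversal at level 3. -/
def W3 : List (List ℕ) := [[], [0], [1], [0, 0], [1, 0], [1, 1], [0, 0, 0], [1, 0, 0], [0, 1, 0], [0, 1, 1],
  [1, 1, 1], [0, 0, 0, 0], [1, 0, 0, 0], [0, 1, 0, 0], [0, 0, 1, 0], [1, 0, 1, 0],
  [1, 0, 1, 1], [0, 1, 1, 1], [1, 1, 0, 0, 0],
  [0, 0, 1, 0, 0]]

/-- Tables of the transversal at level 3 (base point 3). -/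
def UT3 : List (List ℕ) := [
  [0, 1, 2, 3, 4, 5, 6, 7, 8, 9, 10, 11, 12, 13, 14, 15, 16, 17, 18, 19, 20, 21],
  [3, 1, 2, 12, 5, 11, 4, 13, 9, 7, 6, 10, 15, 17, 18, 21, 14, 8, 20, 16, 19, 0],
  [3, 1, 2, 20, 17, 10, 13, 0, 7, 18, 12, 21, 19, 14, 9, 11, 5, 15, 6, 16, 8, 4],
  [12, 1, 2, 15, 11, 10, 5, 17, 7, 13, 4, 6, 21, 8, 20, 0, 18, 9, 19, 14, 16, 3],
  [20, 1, 2, 19, 10, 21, 17, 14, 18, 0, 13, 12, 11, 15, 6, 4, 9, 7, 8, 5, 16, 3],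
  [20, 1, 2, 8, 15, 12, 14, 3, 0, 6, 19, 4, 16, 9, 18, 21, 10, 11, 13, 5, 7, 17],
  [15, 1, 2, 21, 10, 6, 11, 8, 13, 17, 5, 4, 0, 9, 19, 3, 20, 7, 16, 18, 14, 12],
  [19, 1, 2, 11, 21, 12, 10, 15, 0, 14, 17, 13, 4, 7, 8, 3, 6, 18, 16, 9, 5, 20],
  [19, 1, 2, 16, 6, 0, 8, 18, 20, 3, 17, 15, 10, 21, 4, 5, 7, 13, 9, 11, 14, 12],
  [19, 1, 2, 9, 21, 15, 18, 12, 3, 4, 16, 5, 14, 7, 20, 0, 6, 10, 17, 11, 13, 8],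
  [8, 1, 2, 7, 11, 19, 9, 20, 3, 13, 16, 17, 5, 18, 6, 4, 12, 21, 14, 10, 0, 15],
  [21, 1, 2, 0, 6, 4, 10, 9, 17, 8, 11, 5, 3, 7, 16, 12, 19, 13, 14, 20, 18, 15],
  [11, 1, 2, 4, 12, 13, 21, 7, 14, 15, 10, 17, 3, 18, 16, 20, 8, 0, 5, 6, 9, 19],
  [16, 1, 2, 10, 0, 15, 6, 21, 3, 18, 8, 17, 5, 13, 9, 12, 4, 20, 14, 7, 11, 19],
  [16, 1, 2, 14, 4, 3, 9, 20, 19, 12, 8, 21, 6, 0, 5, 11, 13, 17, 7, 10, 18, 15],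
  [16, 1, 2, 5, 13, 3, 7, 6, 8, 20, 15, 11, 12, 4, 17, 10, 0, 14, 18, 21, 9, 19],
  [16, 1, 2, 18, 4, 11, 6, 19, 20, 17, 5, 10, 9, 0, 8, 3, 13, 12, 15, 21, 14, 7],
  [9, 1, 2, 13, 10, 16, 7, 19, 12, 17, 14, 8, 11, 20, 4, 5, 15, 0, 18, 6, 3, 21],
  [21, 1, 2, 17, 19, 14, 4, 0, 9, 11, 12, 15, 20, 6, 5, 8, 7, 3, 10, 13, 18, 16],
  [14, 1, 2, 6, 3, 21, 4, 0, 12, 20, 9, 8, 11, 17, 7, 15, 5, 19, 18, 13, 10, 16]]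

/-- Tables of the generators at level 4. -/
def ST4 : List (List ℕ) := [
  [4, 1, 2, 3, 13, 17, 12, 18, 15, 7, 21, 10, 20, 0, 5, 19, 16, 14, 9, 8, 6, 11],
  [18, 1, 2, 3, 11, 14, 21, 6, 15, 13, 0, 20, 9, 12, 17, 16, 8, 5, 10, 19, 4, 7],
  [0, 1, 2, 3, 13, 14, 9, 20, 7, 11, 18, 6, 21, 16, 17, 12, 4, 5, 19, 10, 8, 15]]

/-- Words for the transversal at level 4. -/
def W4 : List (List ℕ) := [[], [0], [1], [0, 0], [1, 0], [0, 1], [1, 1], [2, 1], [1, 0, 0], [2, 0, 0], [1, 1, 0],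
  [2, 1, 0], [0, 0, 1], [0, 1, 1], [0, 2, 1],
  [2, 0, 1, 1]]

/-- Tables of the transversal at level 4 (base point 0). -/
def UT4 : List (List ℕ) := [
  [0, 1, 2, 3, 4, 5, 6, 7, 8, 9, 10, 11, 12, 13, 14, 15, 16, 17, 18, 19, 20, 21],
  [4, 1, 2, 3, 13, 17, 12, 18, 15, 7, 21, 10, 20, 0, 5, 19, 16, 14, 9, 8, 6, 11],
  [18, 1, 2, 3, 11, 14, 21, 6, 15, 13, 0, 20, 9, 12, 17, 16, 8, 5, 10, 19, 4, 7],
  [13, 1, 2, 3, 0, 14, 20, 9, 19, 18, 11, 21, 6, 4, 17, 8, 16, 5, 7, 15, 12, 10],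
  [11, 1, 2, 3, 12, 5, 9, 10, 16, 6, 7, 0, 4, 18, 14, 19, 8, 17, 13, 15, 21, 20],
  [9, 1, 2, 3, 10, 5, 11, 12, 19, 0, 4, 6, 7, 20, 14, 16, 15, 17, 21, 8, 13, 18],
  [10, 1, 2, 3, 20, 17, 7, 21, 16, 12, 18, 4, 13, 9, 5, 8, 15, 14, 0, 19, 11, 6],
  [19, 1, 2, 3, 6, 17, 15, 9, 12, 16, 0, 8, 11, 21, 5, 4, 7, 14, 18, 10, 13, 20],
  [12, 1, 2, 3, 18, 17, 4, 13, 19, 10, 20, 7, 21, 11, 5, 15, 8, 14, 6, 16, 9, 0],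
  [16, 1, 2, 3, 0, 17, 8, 11, 10, 19, 6, 15, 9, 13, 5, 7, 4, 14, 20, 12, 21, 18],
  [20, 1, 2, 3, 9, 14, 13, 0, 8, 21, 6, 18, 11, 10, 17, 19, 15, 5, 12, 16, 7, 4],
  [6, 1, 2, 3, 21, 14, 11, 18, 4, 9, 20, 0, 13, 19, 17, 10, 7, 5, 16, 12, 15, 8],
  [7, 1, 2, 3, 21, 17, 10, 20, 8, 4, 13, 12, 18, 6, 5, 16, 19, 14, 11, 15, 0, 9],
  [21, 1, 2, 3, 6, 14, 18, 11, 16, 20, 9, 13, 0, 7, 17, 15, 19, 5, 4, 8, 10, 12],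
  [8, 1, 2, 3, 12, 14, 19, 7, 20, 16, 4, 15, 10, 11, 17, 13, 18, 5, 9, 21, 0, 6],
  [15, 1, 2, 3, 9, 17, 19, 6, 4, 8, 11, 16, 0, 20, 5, 12, 10, 14, 13, 7, 18, 21]]

/-- Tables of the generators at level 5. -/
def ST5 : List (List ℕ) := [
  [0, 1, 2, 3, 13, 14, 9, 20, 7, 11, 18, 6, 21, 16, 17, 12, 4, 5, 19, 10, 8, 15]]

/-- Words for the transversal at level 5. -/
def W5 : List (List ℕ) := [[], [0],
  [0, 0]]

/-- Tables of the transversal at level 5 (base point 4). -/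
def UT5 : List (List ℕ) := [
  [0, 1, 2, 3, 4, 5, 6, 7, 8, 9, 10, 11, 12, 13, 14, 15, 16, 17, 18, 19, 20, 21],
  [0, 1, 2, 3, 13, 14, 9, 20, 7, 11, 18, 6, 21, 16, 17, 12, 4, 5, 19, 10, 8, 15],
  [0, 1, 2, 3, 16, 17, 11, 8, 20, 6, 19, 9, 15, 4, 5, 21, 13, 14, 10, 18, 7, 12]]

/-- Generators at level 1. -/
def S1 : List (Equiv.Perm (Fin 22)) := [X, Y, T]

/-- Words defining the generators of level 2. -/
def V2 : List (List ℕ) := [[2], [0, 2, 0, 2, 1, 0]]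

/-- Generators at level 2. -/
def S2 : List (Equiv.Perm (Fin 22)) := V2.map (evW S1)

/-- Words defining the generators of level 3. -/
def V3 : List (List ℕ) := [[1, 1, 1, 0, 1], [0, 1, 0, 1, 1]]

/-- Generators at level 3. -/
def S3 : List (Equiv.Perm (Fin 22)) := V3.map (evW S2)

/-- Words defining the generators of level 4. -/
def V4 : List (List ℕ) := [[1, 0, 0, 0, 0], [0, 0, 1, 1, 0, 0], [0, 1, 0, 1, 0, 0, 1, 0]]

/-- Generators at level 4. -/
def S4 : List (Equiv.Perm (Fin 22)) := V4.map (evW S3)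

/-- Words defining the generators of level 5. -/
def V5 : List (List ℕ) := [[2]]

/-- Generators at level 5. -/
def S5 : List (Equiv.Perm (Fin 22)) := V5.map (evW S4)

theorem hST1 : S1.map enc = ST1 := by decide +kernel

theorem hST2 : S2.map enc = ST2 := by
  rw [S2, map_enc_evW, hST1]
  decide +kernel

theorem hST3 : S3.map enc = ST3 := by
  rw [S3, map_enc_evW, hST2]
  decide +kernel

theorem hST4 : S4.map enc = ST4 := by
  rw [S4, map_enc_evW, hST3]
  decide +kernel

theorem hST5 : S5.map enc = ST5 := by
  rw [S5, map_enc_evW, hST4]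
  decide +kernel

theorem level5 : Nat.card (Subgroup.closure {x | x ∈ S5}) =
      UT5.length * Nat.card (Subgroup.closure {x | x ∈ ([] : List (Equiv.Perm (Fin 22)))}) ∧
    ∀ g, sift [(4, UT5)] (enc g) = true →
      g ∈ Subgroup.closure {x | x ∈ S5} :=
  level S5 ST5 hST5 W5 UT5 (by decide +kernel) 4 [] [] rfl
  [] rfl [] sift_nil
  (by decide +kernel) (by decide +kernel) (by decide +kernel) (by decide +kernel)

theorem level4 : Nat.card (Subgroup.closure {x | x ∈ S4}) =
      UT4.length * Nat.card (Subgroup.closure {x | x ∈ S5}) ∧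
    ∀ g, sift [(0, UT4), (4, UT5)] (enc g) = true →
      g ∈ Subgroup.closure {x | x ∈ S4} :=
  level S4 ST4 hST4 W4 UT4 (by decide +kernel) 0 V5 S5 rfl
  ST5 hST5 [(4, UT5)] level5.2
  (by decide +kernel) (by decide +kernel) (by decide +kernel) (by decide +kernel)

theorem level3 : Nat.card (Subgroup.closure {x | x ∈ S3}) =
      UT3.length * Nat.card (Subgroup.closure {x | x ∈ S4}) ∧
    ∀ g, sift [(3, UT3), (0, UT4), (4, UT5)] (enc g) = true →
      g ∈ Subgroup.closure {x | x ∈ S3} :=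
  level S3 ST3 hST3 W3 UT3 (by decide +kernel) 3 V4 S4 rfl
  ST4 hST4 [(0, UT4), (4, UT5)] level4.2
  (by decide +kernel) (by decide +kernel) (by decide +kernel) (by decide +kernel)

theorem level2 : Nat.card (Subgroup.closure {x | x ∈ S2}) =
      UT2.length * Nat.card (Subgroup.closure {x | x ∈ S3}) ∧
    ∀ g, sift [(2, UT2), (3, UT3), (0, UT4), (4, UT5)] (enc g) = true →
      g ∈ Subgroup.closure {x | x ∈ S2} :=
  level S2 ST2 hST2 W2 UT2 (by decide +kernel) 2 V3 S3 rfl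
  ST3 hST3 [(3, UT3), (0, UT4), (4, UT5)] level3.2
  (by decide +kernel) (by decide +kernel) (by decide +kernel) (by decide +kernel)

theorem level1 : Nat.card (Subgroup.closure {x | x ∈ S1}) =
      UT1.length * Nat.card (Subgroup.closure {x | x ∈ S2}) ∧
    ∀ g, sift [(1, UT1), (2, UT2), (3, UT3), (0, UT4), (4, UT5)] (enc g) = true →
      g ∈ Subgroup.closure {x | x ∈ S1} :=
  level S1 ST1 hST1 W1 UT1 (by decide +kernel) 1 V2 S2 rfl
  ST2 hST2 [(2, UT2), (3, UT3), (0, UT4), (4, UT5)] level2.2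
  (by decide +kernel) (by decide +kernel) (by decide +kernel) (by decide +kernel)

theorem coe_S1 : {x | x ∈ S1} = ({X, Y, T} : Set (Equiv.Perm (Fin 22))) := by
  ext x
  simp [S1]

theorem card_eq : Nat.card (Subgroup.closure ({X, Y, T} : Set (Equiv.Perm (Fin 22)))) =
    443520 := by
  have h0 : Nat.card (Subgroup.closure {x | x ∈ ([] : List (Equiv.Perm (Fin 22)))}) = 1 := by
    simp
  rw [← coe_S1, level1.1, level2.1, level3.1, level4.1, level5.1, h0]
  decide +kernel

theorem evW_mem_XY (w : List ℕ) : evW [X, Y] w ∈ Subgroup.closure {X, Y} := by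
  have := evW_mem [X, Y] w
  have e : {x | x ∈ [X, Y]} = ({X, Y} : Set (Equiv.Perm (Fin 22))) := by
    ext x
    simp
  rwa [e] at this

/-- Product of conjugates of `T` by words in `X, Y`. -/
def conjW (ws : List (List ℕ)) : Equiv.Perm (Fin 22) :=
  ws.foldr (fun w r => ((evW [X, Y] w)⁻¹ * T * evW [X, Y] w) * r) 1

theorem conjW_mem (ws : List (List ℕ)) :
    conjW ws ∈ Subgroup.closure {p : Equiv.Perm (Fin 22) |
        ∃ g ∈ Subgroup.closure {X, Y}, p = g⁻¹ * T * g} := by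
  induction ws with
  | nil => exact one_mem _
  | cons w ws ih =>
    exact mul_mem (Subgroup.subset_closure ⟨_, evW_mem_XY w, rfl⟩) ih

/-- Table version of `conjW`. -/
def conjE (gs : List (List ℕ)) (t : List ℕ) (ws : List (List ℕ)) : List ℕ :=
  ws.foldr (fun w r => mulT (mulT (mulT (invT (evT gs w)) t) (evT gs w)) r) idT

theorem enc_conjW (ws : List (List ℕ)) :
    enc (conjW ws) = conjE ([X, Y].map enc) (enc T) ws := by
  induction ws with
  | nil => exact enc_one
  | cons w ws ih =>
    change enc (((evW [X, Y] w)⁻¹ * T * evW [X, Y] w) * conjW ws) = _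
    rw [enc_mul, enc_mul, enc_mul, enc_inv, enc_evW, ih]
    rfl

/-- Words expressing `X` as a product of conjugates of `T`. -/
def XW : List (List ℕ) :=
  [[], [0, 1, 0, 0, 0, 0], [0], [0, 1, 0, 1], [0, 1, 0, 0, 0, 0], [], [0], []]

theorem X_eq : conjW XW = X := by
  apply enc_inj
  rw [enc_conjW]
  have hx : enc X = ST1.getD 0 [] := by decide +kernel
  have hy : enc Y = ST1.getD 1 [] := by decide +kernel
  have ht : enc T = ST1.getD 2 [] := by decide +kernel
  simp only [List.map_cons, List.map_nil]
  rw [hx, hy, ht]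
  decide +kernel

/-- Words expressing `Y` as a product of conjugates of `T`. -/
def YW : List (List ℕ) :=
  [[0, 0], [0, 0, 1], [0, 0], [0, 0, 1], [0, 0]]

theorem Y_eq : conjW YW = Y := by
  apply enc_inj
  rw [enc_conjW]
  have hx : enc X = ST1.getD 0 [] := by decide +kernel
  have hy : enc Y = ST1.getD 1 [] := by decide +kernel
  have ht : enc T = ST1.getD 2 [] := by decide +kernel
  simp only [List.map_cons, List.map_nil]
  rw [hx, hy, ht]
  decide +kernel

/-- The subgroup generated by the conjugates `{g⁻¹ T g : g ∈ ⟨X, Y⟩}` equals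
`⟨X, Y, T⟩`, and this subgroup has order `443520` (it is `M₂₂`). -/
theorem closure_conjugates_eq_and_card :
    Subgroup.closure {p : Equiv.Perm (Fin 22) |
        ∃ g ∈ Subgroup.closure {X, Y}, p = g⁻¹ * T * g}
      = Subgroup.closure {X, Y, T} ∧
    Nat.card (Subgroup.closure ({X, Y, T} : Set (Equiv.Perm (Fin 22))))
      = 443520 := by
  refine ⟨le_antisymm ?_ ?_, card_eq⟩
  · rw [Subgroup.closure_le]
    rintro p ⟨g, hg, rfl⟩
    have hg' : g ∈ Subgroup.closure ({X, Y, T} : Set (Equiv.Perm (Fin 22))) := by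
      refine Subgroup.closure_mono ?_ hg
      intro x hx
      rcases hx with rfl | rfl <;> simp
    exact mul_mem (mul_mem (inv_mem hg') (Subgroup.subset_closure (by simp))) hg'
  · rw [Subgroup.closure_le]
    intro x hx
    rcases hx with rfl | rfl | rfl
    · have h := conjW_mem XW
      rw [X_eq] at h
      exact h
    · have h := conjW_mem YW
      rw [Y_eq] at h
      exact h
    · exact Subgroup.subset_closure ⟨1, one_mem _, by simp⟩

end M22Perm
end

section
/- In 𝒢 the identity y = t_2 t_3 t_2 t_3 t_2 holds, i.e. y = t^{x^2} · t^{x^3} · t^{x^2} · t^{x^3} · t^{x^2}. -/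
/-!
Symmetric generation of `M₂₂` (Hasan–Lim).  `G` is the quotient of the free
group on three generators `x, y, t` by the normal closure of the relators
`x^7, y^2, (xy)^3, [x,y]^4, t^2, [t^{x^2}, y x⁻¹], [t, y],
 (y t^{x^2})^5, (x y x^2 t^x)^5, (x t)^8`,
where `a ^ b := b⁻¹ a b` and `[a, b] := a⁻¹ b⁻¹ a b`.
-/

namespace M22

abbrev F := FreeGroup (Fin 3)
def fx : F := FreeGroup.of 0
def fy : F := FreeGroup.of 1
def ft : F := FreeGroup.of 2

/-- conjugation `a ^ b = b⁻¹ * a * b` -/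
def fconj (a b : F) : F := b⁻¹ * a * b
/-- commutator `[a, b] = a⁻¹ * b⁻¹ * a * b` -/
def fcomm (a b : F) : F := a⁻¹ * b⁻¹ * a * b

def rels : Set F :=
  {fx ^ 7, fy ^ 2, (fx * fy) ^ 3, (fcomm fx fy) ^ 4, ft ^ 2,
   fcomm (fconj ft (fx ^ 2)) (fy * fx⁻¹), fcomm ft fy,
   (fy * fconj ft (fx ^ 2)) ^ 5, (fx * fy * fx ^ 2 * fconj ft fx) ^ 5,
   (fx * ft) ^ 8}

abbrev G := PresentedGroup rels

def x : G := PresentedGroup.of 0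
def y : G := PresentedGroup.of 1
def t : G := PresentedGroup.of 2

/-- The symmetric generators `t₁, …, t₁₄`: for `1 ≤ i ≤ 7`, `tᵢ = t ^ (xⁱ)`,
and for `1 ≤ k ≤ 7`, `t₍₇₊ₖ₎ = t ^ (x⁵ y x^(k-1))`; the index is read modulo
`14` with representatives `1, …, 14`. -/
def tt (i : ℕ) : G :=
  let j := (i - 1) % 14 + 1
  if j ≤ 7 then (x ^ j)⁻¹ * t * x ^ j
  else (x ^ 5 * y * x ^ (j - 8))⁻¹ * t * (x ^ 5 * y * x ^ (j - 8))

/-- The purely group-theoretic core of the argument. -/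
theorem core {H : Type*} [Group H] (a b s : H) (hb : b ^ 2 = 1) (hs : s ^ 2 = 1)
    (hc : s⁻¹ * (b * a⁻¹)⁻¹ * s * (b * a⁻¹) = 1) (h5 : (b * s) ^ 5 = 1) :
    b = s * (a⁻¹ * s * a) * s * (a⁻¹ * s * a) * s := by
  have hbi : b⁻¹ = b := by rw [inv_eq_iff_mul_eq_one, ← pow_two, hb]
  have hsi : s⁻¹ = s := by rw [inv_eq_iff_mul_eq_one, ← pow_two, hs]
  have h1 : s * (b * a⁻¹) = (b * a⁻¹) * s := by
    have h : ((b * a⁻¹) * s)⁻¹ * (s * (b * a⁻¹)) = 1 := by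
      rw [← hc]; group
    exact (inv_mul_eq_one.mp h).symm
  have h2 : a⁻¹ * s * a = b * s * b := by
    calc a⁻¹ * s * a = b⁻¹ * ((b * a⁻¹) * s) * a := by group
      _ = b⁻¹ * (s * (b * a⁻¹)) * a := by rw [h1]
      _ = b⁻¹ * s * b := by group
      _ = b * s * b := by rw [hbi]
  rw [h2]
  have h3 : s * (b * s * b) * s * (b * s * b) * s = b⁻¹ * (b * s) ^ 5 := by
    simp only [pow_succ, pow_zero]; group
  rw [h3, h5, mul_one, hbi]

theorem rel_one {r : F} (h : r ∈ rels) : PresentedGroup.mk rels r = 1 :=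
  PresentedGroup.one_of_mem h

/-- `y = t₂ t₃ t₂ t₃ t₂` in `G`. -/
theorem y_eq : y = tt 2 * tt 3 * tt 2 * tt 3 * tt 2 := by
  have hx : PresentedGroup.mk rels fx = x := rfl
  have hy : PresentedGroup.mk rels fy = y := rfl
  have ht : PresentedGroup.mk rels ft = t := rfl
  have r1 := rel_one (r := fy ^ 2) (by simp [rels])
  have r2 := rel_one (r := ft ^ 2) (by simp [rels])
  have r3 := rel_one (r := fcomm (fconj ft (fx ^ 2)) (fy * fx⁻¹)) (by simp [rels])
  have r4 := rel_one (r := (fy * fconj ft (fx ^ 2)) ^ 5) (by simp [rels])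
  simp only [fcomm, fconj, map_mul, map_pow, map_inv, hx, hy, ht] at r1 r2 r3 r4
  have e2 : tt 2 = (x ^ 2)⁻¹ * t * x ^ 2 := by simp [tt]
  have e3 : tt 3 = x⁻¹ * tt 2 * x := by
    rw [e2]
    have : tt 3 = (x ^ 3)⁻¹ * t * x ^ 3 := by simp [tt]
    rw [this]; group
  rw [← e2] at r3 r4
  have hs : tt 2 ^ 2 = 1 := by
    have : tt 2 ^ 2 = (x ^ 2)⁻¹ * t ^ 2 * x ^ 2 := by
      rw [e2]; simp only [pow_two]; group
    rw [this, r2]; group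
  rw [e3]
  exact core x y (tt 2) r1 hs r3 r4

end M22
end

section
/- For all i, j ∈ {1,…,7} the elements s_i and s_j of 𝒢 commute: s_i s_j = s_j s_i. In particular the subgroup of 𝒢 generated by s_1,…,s_7 is a commutative group in which every element has order dividing 2. -/
/-!
Symmetric generation of `M₂₂` (Hasan–Lim).  `G` is the quotient of the free
group on three generators `x, y, t` by the normal closure of the relators
`x^7, y^2, (xy)^3, [x,y]^4, t^2, [t^{x^2}, y x⁻¹], [t, y],
 (y t^{x^2})^5, (x y x^2 t^x)^5, (x t)^8`,
where `a ^ b := b⁻¹ a b` and `[a, b] := a⁻¹ b⁻¹ a b`.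
-/

namespace M22

/-- `sᵢ = tᵢ t₍ᵢ₊₇₎`. -/
def s (i : ℕ) : G := tt i * tt (i + 7)

/-! ### Part 1: words, evaluation, and a sound rewriting procedure

Letters: `0 = x`, `1 = x⁻¹`, `2 = y`, and `k + 3` is `t_{k+1}`. -/

/-- The element of `G` denoted by a letter. -/
def letter : ℕ → G
  | 0 => x
  | 1 => x⁻¹
  | 2 => y
  | (k + 3) => tt (k + 1)

/-- The element of `G` denoted by a word. -/
def ev (w : List ℕ) : G := (w.map letter).prod

theorem ev_nil : ev [] = 1 := rfl

theorem ev_cons (a : ℕ) (w : List ℕ) : ev (a :: w) = letter a * ev w := by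
  simp [ev]

theorem ev_append (u v : List ℕ) : ev (u ++ v) = ev u * ev v := by
  simp [ev]

/-- Remove a given prefix. -/
def strip : List ℕ → List ℕ → Option (List ℕ)
  | [], w => some w
  | _ :: _, [] => none
  | a :: l, b :: w => bif Nat.beq a b then strip l w else none

theorem strip_eq : ∀ (l w v : List ℕ), strip l w = some v → w = l ++ v
  | [], w, v, h => by simpa [strip] using h
  | a :: l, [], v, h => by simp [strip] at h
  | a :: l, b :: w, v, h => by
    unfold strip at h
    cases hab : Nat.beq a b with
    | false => simp [hab] at h
    | true =>
      rw [hab] at h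
      have := strip_eq l w v h
      have hab' : a = b := Nat.eq_of_beq_eq_true hab
      simp [hab', this]

/-- A rule is stored as (reversed left-hand side, right-hand side). -/
abbrev Rule := List ℕ × List ℕ

def Valid (R : List Rule) : Prop := ∀ r ∈ R, ev r.1.reverse = ev r.2

/-- Find a rule whose left-hand side ends the (reversed) stack. -/
def findRule : List Rule → List ℕ → Option (List ℕ × List ℕ)
  | [], _ => none
  | r :: R, st =>
    match strip r.1 st with
    | some st' => some (st', r.2)
    | none => findRule R st

theorem findRule_sound : ∀ (R : List Rule), Valid R → ∀ (st st' rhs : List ℕ),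
    findRule R st = some (st', rhs) → ev st.reverse = ev st'.reverse * ev rhs
  | [], _, st, st', rhs, h => by simp [findRule] at h
  | r :: R, hR, st, st', rhs, h => by
    unfold findRule at h
    cases hs : strip r.1 st with
    | some v =>
      rw [hs] at h
      simp only [Option.some.injEq, Prod.mk.injEq] at h
      obtain ⟨rfl, rfl⟩ := h
      rw [strip_eq _ _ _ hs, List.reverse_append, ev_append, hR r (by simp)]
    | none =>
      rw [hs] at h
      exact findRule_sound R (fun r' hr' => hR r' (by simp [hr'])) st st' rhs h

/-- Stack-based rewriting with fuel. -/
def nfAux (R : List Rule) : ℕ → List ℕ → List ℕ → List ℕ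
  | 0, st, inp => st.reverse ++ inp
  | _ + 1, st, [] => st.reverse
  | n + 1, st, a :: inp =>
    match findRule R (a :: st) with
    | some (st', rhs) => nfAux R n st' (rhs ++ inp)
    | none => nfAux R n (a :: st) inp

theorem nfAux_sound (R : List Rule) (hR : Valid R) : ∀ (n : ℕ) (st inp : List ℕ),
    ev (nfAux R n st inp) = ev st.reverse * ev inp
  | 0, st, inp => by simp [nfAux, ev_append]
  | _ + 1, st, [] => by simp [nfAux, ev_nil]
  | n + 1, st, a :: inp => by
    have key : ev st.reverse * ev (a :: inp) = ev (a :: st).reverse * ev inp := by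
      simp [ev_append, ev_cons, ev_nil, mul_assoc]
    unfold nfAux
    cases hf : findRule R (a :: st) with
    | some p =>
      obtain ⟨st', rhs⟩ := p
      simp only
      rw [nfAux_sound R hR n, key, findRule_sound R hR _ _ _ hf, ev_append, mul_assoc]
    | none =>
      simp only
      rw [nfAux_sound R hR n, key]

def nf (R : List Rule) (w : List ℕ) : List ℕ := nfAux R 1000 [] w

theorem nf_sound (R : List Rule) (hR : Valid R) (w : List ℕ) : ev (nf R w) = ev w := by
  rw [nf, nfAux_sound R hR]; simp [ev_nil]

/-- Apply rule number `i` at position `p`. -/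
def rwAt (R : List Rule) (w : List ℕ) (i p : ℕ) : List ℕ :=
  let r := R.getD i ([], [])
  match strip r.1.reverse (w.drop p) with
  | some v => w.take p ++ (r.2 ++ v)
  | none => w

theorem rwAt_sound (R : List Rule) (hR : Valid R) (w : List ℕ) (i p : ℕ) :
    ev (rwAt R w i p) = ev w := by
  have hr : ev (R.getD i ([], [])).1.reverse = ev (R.getD i ([], [])).2 := by
    by_cases hi : i < R.length
    · rw [List.getD_eq_getElem _ _ hi]
      exact hR _ (List.getElem_mem hi)
    · rw [List.getD_eq_default _ _ (not_lt.mp hi)]; rfl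
  unfold rwAt
  simp only
  cases hs : strip (R.getD i ([], [])).1.reverse (w.drop p) with
  | none => rfl
  | some v =>
    have h := strip_eq _ _ _ hs
    simp only
    conv_rhs => rw [← List.take_append_drop p w, h]
    simp only [ev_append, hr]

/-- Add the rules obtained from a list of superpositions. -/
def complete : List (List ℕ × ℕ × ℕ × ℕ × ℕ) → List Rule → List Rule
  | [], R => R
  | (w, i, p, j, q) :: cs, R =>
    complete cs (R ++ [((nf R (rwAt R w i p)).reverse, nf R (rwAt R w j q))])

theorem complete_valid : ∀ (cs : List (List ℕ × ℕ × ℕ × ℕ × ℕ)) (R : List Rule),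
    Valid R → Valid (complete cs R)
  | [], _, hR => hR
  | (w, i, p, j, q) :: cs, R, hR => by
    unfold complete
    apply complete_valid cs
    intro r hr
    rw [List.mem_append, List.mem_singleton] at hr
    rcases hr with hr | rfl
    · exact hR r hr
    · simp only [List.reverse_reverse]
      rw [nf_sound R hR, nf_sound R hR, rwAt_sound R hR, rwAt_sound R hR]

theorem mk_fx : PresentedGroup.mk rels fx = x := rfl
theorem mk_fy : PresentedGroup.mk rels fy = y := rfl
theorem mk_ft : PresentedGroup.mk rels ft = t := rfl

theorem hx7 : x ^ 7 = 1 := by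
  have h := rel_one (r := fx ^ 7) (by simp [rels])
  simpa only [map_pow, mk_fx] using h

theorem hy2 : y ^ 2 = 1 := by
  have h := rel_one (r := fy ^ 2) (by simp [rels])
  simpa only [map_pow, mk_fy] using h

theorem hxy3 : (x * y) ^ 3 = 1 := by
  have h := rel_one (r := (fx * fy) ^ 3) (by simp [rels])
  simpa only [map_pow, map_mul, mk_fx, mk_fy] using h

theorem hcomm4 : (x⁻¹ * y⁻¹ * x * y) ^ 4 = 1 := by
  have h := rel_one (r := (fcomm fx fy) ^ 4) (by simp [rels])
  simpa only [fcomm, map_pow, map_mul, map_inv, mk_fx, mk_fy] using h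

theorem ht2 : t ^ 2 = 1 := by
  have h := rel_one (r := ft ^ 2) (by simp [rels])
  simpa only [map_pow, mk_ft] using h

theorem hty : t⁻¹ * y⁻¹ * t * y = 1 := by
  have h := rel_one (r := fcomm ft fy) (by simp [rels])
  simpa only [fcomm, map_mul, map_inv, mk_fy, mk_ft] using h

theorem htyx : ((x ^ 2)⁻¹ * t * x ^ 2)⁻¹ * (y * x⁻¹)⁻¹ * ((x ^ 2)⁻¹ * t * x ^ 2) * (y * x⁻¹)
    = 1 := by
  have h := rel_one (r := fcomm (fconj ft (fx ^ 2)) (fy * fx⁻¹)) (by simp [rels])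
  simpa only [fcomm, fconj, map_mul, map_inv, map_pow, mk_fx, mk_fy, mk_ft] using h

theorem hr5 : (y * tt 2) ^ 5 = 1 := by
  have h := rel_one (r := (fy * fconj ft (fx ^ 2)) ^ 5) (by simp [rels])
  have h1 : tt 2 = (x ^ 2)⁻¹ * t * x ^ 2 := by simp [tt]
  rw [h1]
  simpa only [fconj, map_mul, map_inv, map_pow, mk_fx, mk_fy, mk_ft] using h

theorem hr5' : (x * y * x ^ 2 * tt 1) ^ 5 = 1 := by
  have h := rel_one (r := (fx * fy * fx ^ 2 * fconj ft fx) ^ 5) (by simp [rels])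
  have h1 : tt 1 = x⁻¹ * t * x := by simp [tt]
  rw [h1]
  simpa only [fconj, map_mul, map_inv, map_pow, mk_fx, mk_fy, mk_ft] using h

theorem yy : y * y = 1 := by rw [← pow_two, hy2]
theorem y_inv : y⁻¹ = y := inv_eq_of_mul_eq_one_left yy
theorem t_sq : t * t = 1 := by rw [← pow_two, ht2]

/-- Base rules for the subgroup generated by `x` and `y`. -/
def baseRules : List Rule :=
  [([1, 0], []), ([0, 1], []), ([2, 2], []), ([0, 0, 0, 0, 0, 0, 0], []),
   ([2, 0, 2, 0, 2, 0], []),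
   ([2, 0, 2, 1, 2, 0, 2, 1, 2, 0, 2, 1, 2, 0, 2, 1], [])]

theorem baseRules_valid : Valid baseRules := by
  intro r hr
  simp only [baseRules, List.mem_cons, List.not_mem_nil, or_false] at hr
  rcases hr with rfl | rfl | rfl | rfl | rfl | rfl
  · simp [ev, letter]
  · simp [ev, letter]
  · simp [ev, letter, yy]
  · simpa [ev, letter, pow_succ, mul_assoc] using hx7
  · simpa [ev, letter, pow_succ, mul_assoc] using hxy3
  · simpa [ev, letter, pow_succ, mul_assoc, y_inv] using hcomm4

/-! ### Part 3: certificates (superpositions for `⟨x, y⟩`, stabiliser words, relators) -/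

def ruleCerts : List (List ℕ × ℕ × ℕ × ℕ × ℕ) :=
  [([1, 0, 2, 0, 2, 0, 2], 1, 0, 4, 1),
   ([2, 2, 0, 2, 0, 2], 2, 0, 6, 1),
   ([1, 0, 2, 0, 2], 7, 1, 1, 0),
   ([1, 2, 1, 0], 8, 0, 1, 2),
   ([2, 2, 0, 2, 0], 2, 0, 9, 1),
   ([1, 0, 0, 0, 0, 0, 0, 0], 1, 0, 3, 1),
   ([1, 0, 0, 0, 0, 0, 0], 1, 0, 11, 1),
   ([1, 0, 0, 0, 0, 0], 1, 0, 12, 1),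
   ([1, 0, 0, 0, 0], 13, 1, 1, 0),
   ([1, 2, 1, 1, 1, 1], 8, 0, 14, 2),
   ([0, 2, 0, 0, 0, 0], 10, 0, 13, 2),
   ([0, 0, 0, 0, 2, 0], 10, 3, 13, 0),
   ([1, 1, 1, 1, 2, 1], 8, 3, 14, 0),
   ([1, 2, 1, 1, 1, 2, 0, 2], 8, 0, 18, 2),
   ([0, 2, 0, 0, 0, 2, 1, 2], 10, 0, 17, 2),
   ([0, 0, 0, 2, 1, 2, 0, 2, 1, 1, 1], 17, 0, 15, 5),
   ([0, 1, 2, 0, 2, 1, 2, 0, 2, 1, 2, 0, 2, 1, 2, 0, 2], 0, 0, 5, 1),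
   ([2, 2, 0, 2, 1, 2, 0, 2, 1, 2, 0, 2, 1, 2, 0, 2], 2, 0, 22, 1),
   ([1, 0, 2, 1, 2, 0, 2, 1, 2, 0, 2, 1, 2, 0, 2], 1, 0, 23, 1),
   ([2, 2, 1, 2, 0, 2, 1, 2, 0, 2, 1, 2, 0, 2], 2, 0, 24, 1),
   ([0, 1, 2, 0, 2, 1, 2, 0, 2, 1, 2, 0, 2], 0, 0, 25, 1),
   ([2, 2, 0, 2, 1, 2, 0, 2, 1, 2, 0, 2], 2, 0, 26, 1),
   ([1, 0, 2, 1, 2, 0, 2, 1, 2, 0, 2], 1, 0, 27, 1),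
   ([2, 2, 1, 2, 0, 2, 1, 2, 0, 2], 2, 0, 28, 1),
   ([1, 2, 0, 2, 1, 2, 0, 2, 0], 29, 0, 10, 6),
   ([2, 2, 1, 2, 0, 2, 1, 2, 0, 0], 2, 0, 30, 1),
   ([1, 2, 0, 2, 1, 2, 0, 0, 0], 31, 0, 16, 3),
   ([2, 2, 1, 2, 0, 2, 1, 1, 2, 0], 32, 1, 2, 0),
   ([1, 2, 1, 2, 0, 2, 1, 2, 0, 2], 29, 2, 8, 0),
   ([1, 1, 1, 2, 0, 2, 1, 2, 0], 34, 1, 18, 0),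
   ([1, 1, 2, 0, 2, 1, 2, 0, 1], 34, 0, 0, 7),
   ([2, 2, 0, 0, 2, 1, 2, 0, 2, 1], 2, 0, 36, 1),
   ([1, 0, 0, 2, 1, 2, 0, 2, 1], 37, 1, 1, 0),
   ([0, 0, 0, 2, 1, 2, 0, 2, 1], 37, 1, 17, 0),
   ([2, 2, 0, 2, 1, 2, 0, 2, 1, 2], 2, 0, 38, 1),
   ([0, 2, 1, 2, 0, 2, 1, 2, 1], 40, 0, 8, 6),
   ([2, 2, 0, 2, 1, 2, 0, 2, 1, 1], 2, 0, 41, 1),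
   ([0, 2, 1, 2, 0, 2, 1, 1, 1], 42, 0, 15, 3),
   ([1, 2, 1, 2, 0, 2, 1, 2, 0, 0], 31, 2, 8, 0),
   ([1, 1, 1, 2, 0, 2, 1, 1, 2], 44, 1, 18, 0),
   ([1, 1, 2, 0, 2, 1, 1, 2, 2], 44, 0, 2, 7),
   ([2, 2, 0, 0, 2, 1, 2, 0, 0, 2], 2, 0, 46, 1),
   ([0, 0, 0, 2, 1, 2, 0, 0, 2], 47, 1, 17, 0),
   ([1, 2, 1, 2, 0, 2, 1, 1, 2, 0], 32, 1, 8, 0),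
   ([1, 1, 1, 2, 0, 0, 2, 1, 1, 1], 21, 0, 49, 1),
   ([0, 2, 0, 2, 1, 2, 0, 0, 2, 1], 43, 1, 10, 0),
   ([0, 0, 0, 2, 1, 1, 2, 0, 0, 0], 50, 0, 51, 1),
   ([0, 0, 0, 2, 1, 2, 0, 2, 1, 2], 17, 0, 40, 2),
   ([0, 1, 1, 1, 2, 0, 0, 2, 1, 2], 53, 1, 0, 0),
   ([0, 0, 0, 2, 1, 2, 0, 2, 1, 1], 17, 0, 42, 2),
   ([0, 1, 1, 1, 2, 0, 0, 2, 1, 1], 55, 1, 0, 0),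
   ([1, 1, 1, 2, 0, 2, 1, 2, 0, 2], 18, 0, 29, 2),
   ([1, 1, 1, 2, 0, 2, 1, 2, 0, 0], 18, 0, 31, 2),
   ([1, 0, 0, 0, 2, 1, 1, 2, 0, 0], 58, 1, 1, 0),
   ([2, 0, 2, 1, 1, 2, 0, 2, 1, 2], 19, 0, 39, 1),
   ([2, 0, 2, 1, 1, 2, 0, 2, 1, 1], 19, 0, 48, 1),
   ([2, 1, 2, 0, 0, 2, 1, 2, 0, 2], 20, 0, 35, 1),
   ([2, 1, 2, 0, 0, 2, 1, 2, 0, 0], 20, 0, 45, 1),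
   ([2, 1, 2, 0, 2, 1, 1, 2, 0, 2], 32, 0, 19, 2),
   ([2, 1, 2, 0, 0, 2, 1, 1, 1, 0], 33, 0, 1, 8),
   ([0, 1, 2, 0, 2, 1, 1, 2, 0, 0], 65, 1, 0, 0),
   ([2, 0, 2, 1, 2, 0, 0, 2, 1, 2], 43, 0, 20, 2),
   ([1, 2, 0, 0, 2, 1, 2, 0, 0, 0], 45, 0, 16, 4),
   ([1, 1, 2, 0, 0, 2, 1, 1, 1, 0], 49, 0, 1, 8),
   ([2, 2, 0, 0, 2, 1, 1, 2, 0, 0], 69, 1, 2, 0),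
   ([1, 2, 0, 0, 2, 1, 1, 1, 2, 1], 8, 7, 64, 0),
   ([0, 2, 1, 1, 2, 0, 0, 0, 2, 0], 10, 7, 67, 0),
   ([2, 2, 1, 1, 2, 0, 0, 0, 2, 1, 1], 2, 0, 72, 1)]

def stabTable : List (List (List ℕ)) :=
  [[[], [], [], [], [], [], [], [], [], [], [], [], [], []],
   [[], [], [], [], [], [], [], [], [], [], [], [], [], []],
   [[1, 0, 2], [1], [2], [0, 2], [], [2, 0, 1], [0], [], [0, 2], [1, 0], [1, 0], [1, 0, 2], [2, 0, 1], [2, 0, 1]]]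

def permTable : List (List ℕ) :=
  [[1, 2, 3, 4, 5, 6, 0, 8, 9, 10, 11, 12, 13, 7],
   [6, 0, 1, 2, 3, 4, 5, 13, 7, 8, 9, 10, 11, 12],
   [11, 2, 1, 10, 7, 12, 6, 4, 9, 8, 3, 0, 5, 13]]

def relCerts : List (List ℕ × List (List ℕ × ℕ × Bool) × List ℕ) :=
  [([0, 2, 0, 0, 2, 7, 3, 10, 14, 10, 3],
    [([1, 1, 2, 1], 1, false),
     ([0, 0, 2, 0, 0, 2, 1, 11], 0, true)],
    [0, 0, 2, 1, 1, 1, 3]),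
   ([7, 14, 7, 14],
    [([1, 1, 2, 1, 1, 2, 0], 2, false),
     ([0, 0, 2, 0, 0, 2, 1], 0, false),
     ([2, 0, 0, 2, 1, 1, 1, 10], 1, true)],
    [0, 2, 0, 0, 14]),
   ([0, 0, 2, 1, 1, 2, 0, 13, 14, 4, 13, 14],
    [([0, 2, 0, 0, 0, 2, 0, 0, 12, 15, 7], 2, false),
     ([0, 0, 2, 1, 1, 1, 2, 0, 0, 15], 2, false),
     ([1, 2, 1, 1, 2, 12], 2, false),
     ([1, 2, 0, 0, 0, 2, 0, 10, 12, 5], 1, false),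
     ([1, 1, 2, 0, 0, 0, 10, 3], 2, false),
     ([0, 2, 0, 0, 10], 3, false),
     ([1, 1, 2, 1], 2, false),
     ([0, 0, 0, 3, 13, 6, 3, 14, 3, 10, 7], 2, true),
     ([0, 0, 0, 2, 0, 15, 7, 14, 8, 14, 3, 10, 7], 2, true),
     ([1, 2, 1, 1, 2, 7], 2, true)],
    [2, 0, 0, 0, 13, 14]),
   ([6, 13, 5, 12, 10, 3],
    [([1, 1, 2, 0, 0, 2, 1, 1, 15, 8], 4, false),
     ([1, 2, 10, 3], 2, false),
     ([1, 1, 1, 2, 5], 2, false),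
     ([1, 1, 2, 0, 0, 0, 7], 2, false),
     ([0, 0, 0, 2, 0, 15, 7, 14, 8, 14], 2, true),
     ([0, 2, 0, 0, 0, 2, 5, 4, 5], 0, true),
     ([0, 0, 0, 2, 0, 0, 2, 11], 2, true),
     ([0, 0, 0, 2, 1, 1, 1, 7], 2, true)],
    [2, 1, 1, 2, 0, 0, 0, 2]),
   ([2, 0, 0, 2, 1, 1, 1, 5, 10, 6, 5, 10],
    [([1, 1, 1, 2], 3, false),
     ([2, 0, 0, 0, 13], 5, true),
     ([1, 1, 1, 2, 7], 2, true),
     ([1, 1, 1, 2, 0, 11], 4, true)],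
    [0, 0, 0, 2, 1, 1, 1, 2, 10]),
   ([9, 16, 9, 16],
    [([1, 2, 1, 14], 3, true)],
    [0, 2, 0, 9]),
   ([8, 15, 6, 13, 9, 16],
    [([0, 0, 0, 2, 1, 1, 2, 14], 2, true),
     ([0, 2, 0, 0, 0, 2, 0, 0, 7], 2, true),
     ([1, 2, 1, 1, 2, 0, 0, 12, 5], 3, true),
     ([1, 1, 1, 2, 1, 1, 7], 2, true),
     ([0, 0, 0, 2, 1, 1, 2, 0, 13], 6, true),
     ([0, 0, 2, 1, 1, 1, 2, 0, 0, 2, 13, 4], 4, true)],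
    [0, 0])]

/-- A complete enough set of rules for `⟨x, y⟩`. -/
def rules : List Rule := complete ruleCerts baseRules

theorem rules_valid : Valid rules := complete_valid _ _ baseRules_valid

/-! ### Part 4: the action of `x, x⁻¹, y` on the symmetric generators -/

/-- Coset words: `t_{k+1} = c⁻¹ t c` with `c` the value of `cosetWord k`. -/
def cosetWord (k : ℕ) : List ℕ :=
  if k < 7 then List.replicate (k + 1) 0
  else [0, 0, 0, 0, 0, 2] ++ List.replicate (k - 7) 0

def invLetter : ℕ → ℕ
  | 0 => 1
  | 1 => 0
  | k => k

/-- Formal inverse of a word. -/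
def invWord (w : List ℕ) : List ℕ := (w.map invLetter).reverse

/-- Words for generators of the stabiliser of `t`. -/
def stabGen : ℕ → List ℕ
  | 0 => [2]
  | 1 => [0, 0, 2, 1, 1, 1]
  | _ => [0, 0, 0, 2, 1, 1]

def stabWord (w : List ℕ) : List ℕ := w.flatMap stabGen

theorem ev_replicate (k : ℕ) : ev (List.replicate k 0) = x ^ k := by
  simp [ev, letter]

theorem tt_eq (k : ℕ) (hk : k < 14) :
    tt (k + 1) = (ev (cosetWord k))⁻¹ * t * ev (cosetWord k) := by
  have hmod : k % 14 = k := Nat.mod_eq_of_lt hk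
  unfold tt cosetWord
  simp only [Nat.add_sub_cancel, hmod]
  by_cases h : k < 7
  · rw [if_pos h, if_pos (by omega), ev_replicate]
  · rw [if_neg h, if_neg (by omega), ev_append, ev_replicate]
    have : k + 1 - 8 = k - 7 := by omega
    rw [this]
    have h5 : ev [0, 0, 0, 0, 0, 2] = x ^ 5 * y := by
      simp [ev, letter, pow_succ, mul_assoc]
    rw [h5]

theorem tt_sq (k : ℕ) (hk : k < 14) : tt (k + 1) * tt (k + 1) = 1 := by
  rw [tt_eq k hk]
  have : ∀ c : G, c⁻¹ * t * c * (c⁻¹ * t * c) = c⁻¹ * (t * t) * c := by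
    intro c; group
  rw [this, t_sq]; group

theorem letter_inv (a : ℕ) (ha : a < 17) : letter (invLetter a) = (letter a)⁻¹ := by
  match a, ha with
  | 0, _ => rfl
  | 1, _ => simp [invLetter, letter]
  | 2, _ => exact y_inv.symm
  | k + 3, h =>
    exact (inv_eq_of_mul_eq_one_left (tt_sq k (by omega))).symm

theorem ev_invWord : ∀ (w : List ℕ), (∀ a ∈ w, a < 17) → ev (invWord w) = (ev w)⁻¹
  | [], _ => by simp [invWord, ev]
  | a :: w, h => by
    have ih := ev_invWord w (fun b hb => h b (by simp [hb]))
    have h1 : invWord (a :: w) = invWord w ++ [invLetter a] := by simp [invWord]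
    rw [h1, ev_append, ih, ev_cons, ev_cons, ev_nil, mul_one, letter_inv a (h a (by simp)),
      mul_inv_rev]

theorem t_comm_stabGen (k : ℕ) : Commute t (ev (stabGen k)) := by
  have h0 : Commute t y := by
    have h := hty
    have h2 : t⁻¹ * y⁻¹ * t * y = (y * t)⁻¹ * (t * y) := by group
    rw [h2] at h
    exact (inv_mul_eq_one.mp h).symm
  have h1 : Commute t (x * x * y * x⁻¹ * x⁻¹ * x⁻¹) := by
    have h := htyx
    have h2 : ((x ^ 2)⁻¹ * t * x ^ 2)⁻¹ * (y * x⁻¹)⁻¹ * ((x ^ 2)⁻¹ * t * x ^ 2) * (y * x⁻¹)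
        = (x * x)⁻¹ * ((x * x * y * x⁻¹ * x⁻¹ * x⁻¹ * t)⁻¹ *
            (t * (x * x * y * x⁻¹ * x⁻¹ * x⁻¹))) * (x * x) := by
      simp [pow_two, mul_assoc]
    rw [h2] at h
    have h3 : (x * x * y * x⁻¹ * x⁻¹ * x⁻¹ * t)⁻¹ *
            (t * (x * x * y * x⁻¹ * x⁻¹ * x⁻¹)) = 1 := by
      have h4 := congrArg (fun z => (x * x) * z * (x * x)⁻¹) h
      simpa [mul_assoc] using h4
    exact (inv_mul_eq_one.mp h3).symm
  match k with
  | 0 => simpa [stabGen, ev, letter] using h0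
  | 1 => simpa [stabGen, ev, letter, mul_assoc] using h1
  | k + 2 =>
    have h2 := h1.inv_right
    simpa [stabGen, ev, letter, mul_assoc, y_inv] using h2

theorem t_comm_stabWord : ∀ (w : List ℕ), Commute t (ev (stabWord w))
  | [] => Commute.one_right t
  | a :: w => by
    have h1 : stabWord (a :: w) = stabGen a ++ stabWord w := by simp [stabWord]
    rw [h1, ev_append]
    exact (t_comm_stabGen a).mul_right (t_comm_stabWord w)

/-- The action of the letter `g < 3` on the index `k < 14`. -/
def perm (g k : ℕ) : ℕ := (permTable.getD g []).getD k 0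

def actCheck : Bool :=
  (List.range 3).all fun g => (List.range 14).all fun k =>
    decide (perm g k < 14) &&
    decide (nf rules (cosetWord k ++ ([g] ++ invWord (cosetWord (perm g k)))) =
      nf rules (stabWord ((stabTable.getD g []).getD k [])))

theorem actCheck_true : actCheck = true := by decide +kernel

theorem cosetWord_lt (k a : ℕ) (h : a ∈ cosetWord k) : a < 17 := by
  unfold cosetWord at h
  split_ifs at h
  · rw [List.eq_of_mem_replicate h]; norm_num
  · rw [List.mem_append] at h
    rcases h with h | h
    · simp at h; omega
    · rw [List.eq_of_mem_replicate h]; norm_num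

theorem act_spec (g k : ℕ) (hg : g < 3) (hk : k < 14) :
    perm g k < 14 ∧ tt (k + 1) * letter g = letter g * tt (perm g k + 1) := by
  have h := actCheck_true
  unfold actCheck at h
  rw [List.all_eq_true] at h
  have h1 := h g (List.mem_range.mpr hg)
  rw [List.all_eq_true] at h1
  have h2 := h1 k (List.mem_range.mpr hk)
  rw [Bool.and_eq_true, decide_eq_true_eq, decide_eq_true_eq] at h2
  obtain ⟨hp, he⟩ := h2
  refine ⟨hp, ?_⟩
  have h3 := congrArg ev he
  rw [nf_sound rules rules_valid, nf_sound rules rules_valid, ev_append, ev_append,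
    ev_invWord _ (cosetWord_lt _), ev_cons, ev_nil, mul_one] at h3
  have h4 := t_comm_stabWord ((stabTable.getD g []).getD k [])
  rw [← h3] at h4
  rw [tt_eq k hk, tt_eq _ hp]
  have h5 := h4.eq
  generalize ev (cosetWord k) = c at *
  generalize ev (cosetWord (perm g k)) = d at *
  generalize letter g = z at *
  have h6 : c⁻¹ * t * c * z = c⁻¹ * (t * (c * (z * d⁻¹))) * d := by group
  rw [h6, h5]; group

/-! ### Part 5: normal form `n * (word in the symmetric generators)` -/

/-- Split a word into (reversed) `⟨x,y⟩`-part and (reversed) list of indices of generators. -/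
def split : List ℕ → List ℕ → List ℕ → List ℕ × List ℕ
  | n, ts, [] => (n, ts)
  | n, ts, 0 :: w => split (0 :: n) (ts.map (perm 0)) w
  | n, ts, 1 :: w => split (1 :: n) (ts.map (perm 1)) w
  | n, ts, 2 :: w => split (2 :: n) (ts.map (perm 2)) w
  | n, [], (k + 3) :: w => split n [k] w
  | n, a :: ts, (k + 3) :: w =>
    bif Nat.beq a k then split n ts w else split n (k :: a :: ts) w

/-- Value of a reversed list of indices of generators. -/
def evT : List ℕ → G
  | [] => 1
  | k :: ts => evT ts * tt (k + 1)

theorem evT_perm (g : ℕ) (hg : g < 3) : ∀ (ts : List ℕ), (∀ k ∈ ts, k < 14) →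
    (∀ k ∈ ts.map (perm g), k < 14) ∧ evT ts * letter g = letter g * evT (ts.map (perm g))
  | [], _ => by simp [evT]
  | k :: ts, h => by
    obtain ⟨h1, h2⟩ := evT_perm g hg ts (fun a ha => h a (by simp [ha]))
    obtain ⟨h3, h4⟩ := act_spec g k hg (h k (by simp))
    constructor
    · intro a ha
      rw [List.map_cons, List.mem_cons] at ha
      rcases ha with rfl | ha
      · exact h3
      · exact h1 a ha
    · simp only [List.map_cons, evT]
      rw [mul_assoc, h4, ← mul_assoc, h2, mul_assoc]

theorem split_perm (g : ℕ) (hg : g < 3) (n ts w : List ℕ) (h : ∀ k ∈ ts, k < 14) :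
    ev (g :: n).reverse * evT (ts.map (perm g)) * ev w
      = ev n.reverse * evT ts * ev (g :: w) := by
  rw [List.reverse_cons, ev_append, ev_cons, ev_nil, mul_one, ev_cons,
    mul_assoc (ev n.reverse), ← (evT_perm g hg ts h).2]
  simp only [mul_assoc]

theorem split_sound : ∀ (w n ts : List ℕ), (∀ a ∈ w, a < 17) → (∀ k ∈ ts, k < 14) →
    ev (split n ts w).1.reverse * evT (split n ts w).2 = ev n.reverse * evT ts * ev w
  | [], n, ts, _, _ => by simp [split, ev_nil]
  | 0 :: w, n, ts, hw, h => by
    unfold split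
    rw [split_sound w _ _ (fun a ha => hw a (by simp [ha])) (evT_perm 0 (by norm_num) ts h).1,
      split_perm 0 (by norm_num) n ts w h]
  | 1 :: w, n, ts, hw, h => by
    unfold split
    rw [split_sound w _ _ (fun a ha => hw a (by simp [ha])) (evT_perm 1 (by norm_num) ts h).1,
      split_perm 1 (by norm_num) n ts w h]
  | 2 :: w, n, ts, hw, h => by
    unfold split
    rw [split_sound w _ _ (fun a ha => hw a (by simp [ha])) (evT_perm 2 (by norm_num) ts h).1,
      split_perm 2 (by norm_num) n ts w h]
  | (k + 3) :: w, n, [], hw, h => by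
    have hk : k < 14 := by have := hw (k + 3) (by simp); omega
    unfold split
    rw [split_sound w n [k] (fun a ha => hw a (by simp [ha])) (by simpa using hk)]
    simp [evT, ev_cons, letter, mul_assoc]
  | (k + 3) :: w, n, b :: ts, hw, h => by
    have hk : k < 14 := by have := hw (k + 3) (by simp); omega
    have hw' : ∀ a ∈ w, a < 17 := fun a ha => hw a (by simp [ha])
    unfold split
    cases hb : Nat.beq b k with
    | true =>
      have hb' : b = k := Nat.eq_of_beq_eq_true hb
      subst hb'
      rw [cond_true, split_sound w n ts hw' (fun a ha => h a (by simp [ha])), ev_cons]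
      have h1 : ev n.reverse * evT (b :: ts) * (letter (b + 3) * ev w)
          = ev n.reverse * evT ts * (tt (b + 1) * tt (b + 1)) * ev w := by
        simp only [evT, letter, mul_assoc]
      rw [h1, tt_sq b hk, mul_one]
    | false =>
      rw [cond_false, split_sound w n (k :: b :: ts) hw' ?_]
      · simp only [evT, ev_cons, letter, mul_assoc]
      · intro a ha
        rw [List.mem_cons] at ha
        rcases ha with rfl | ha
        · exact hk
        · exact h a ha

/-- Normal form of a word in `x, x⁻¹, y, t_i`. -/
def canon (w : List ℕ) : List ℕ × List ℕ :=
  let p := split [] [] w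
  (nf rules p.1.reverse, p.2)

theorem canon_sound (w : List ℕ) (hw : ∀ a ∈ w, a < 17) :
    ev w = ev (canon w).1 * evT (canon w).2 := by
  unfold canon
  simp only
  rw [nf_sound rules rules_valid, split_sound w [] [] hw (by simp)]
  simp [ev_nil, evT]

/-- All letters of a word are in range. -/
def okWord (w : List ℕ) : Bool := w.all fun a => Nat.blt a 17

theorem okWord_spec {w : List ℕ} (h : okWord w = true) : ∀ a ∈ w, a < 17 := by
  unfold okWord at h
  rw [List.all_eq_true] at h
  intro a ha
  simpa [Nat.blt_eq] using h a ha

theorem ev_eq_of_canon {u v : List ℕ} (hu : okWord u = true) (hv : okWord v = true)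
    (h : canon u = canon v) : ev u = ev v := by
  rw [canon_sound u (okWord_spec hu), canon_sound v (okWord_spec hv), h]

/-! ### Part 6: deriving relators as products of conjugates -/

def ValidRels (L : List (List ℕ)) : Prop := ∀ w ∈ L, okWord w = true ∧ ev w = 1

def pick (L : List (List ℕ)) (i : ℕ) (b : Bool) : List ℕ :=
  bif b then L.getD i [] else invWord (L.getD i [])

theorem pick_sound (L : List (List ℕ)) (hL : ValidRels L) (i : ℕ) (b : Bool) :
    ev (pick L i b) = 1 := by
  have hr : okWord (L.getD i []) = true ∧ ev (L.getD i []) = 1 := by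
    by_cases hi : i < L.length
    · rw [List.getD_eq_getElem _ _ hi]
      exact hL _ (List.getElem_mem hi)
    · rw [List.getD_eq_default _ _ (not_lt.mp hi)]; exact ⟨rfl, rfl⟩
  cases b with
  | true => exact hr.2
  | false =>
    unfold pick
    rw [cond_false, ev_invWord _ (okWord_spec hr.1), hr.2, inv_one]

/-- The product with the relators left out. -/
def bare : List (List ℕ × ℕ × Bool) → List ℕ → List ℕ
  | [], v => v
  | (a, _, _) :: c, v => a ++ bare c v

/-- The product with the relators put in. -/
def full (L : List (List ℕ)) : List (List ℕ × ℕ × Bool) → List ℕ → List ℕ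
  | [], v => v
  | (a, i, b) :: c, v => a ++ (pick L i b ++ full L c v)

theorem full_eq (L : List (List ℕ)) (hL : ValidRels L) (v : List ℕ) :
    ∀ c, ev (full L c v) = ev (bare c v)
  | [] => rfl
  | (a, i, b) :: c => by
    simp only [full, bare, ev_append, pick_sound L hL, one_mul, full_eq L hL v c]

def derivable (L : List (List ℕ)) (c : List ℕ × List (List ℕ × ℕ × Bool) × List ℕ) : Bool :=
  okWord c.1 && okWord (full L c.2.1 c.2.2) && okWord (bare c.2.1 c.2.2) &&
    decide (canon (full L c.2.1 c.2.2) = canon c.1) &&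
    decide (canon (bare c.2.1 c.2.2) = ([], []))

theorem derivable_sound (L : List (List ℕ)) (hL : ValidRels L)
    (c : List ℕ × List (List ℕ × ℕ × Bool) × List ℕ) (h : derivable L c = true) :
    okWord c.1 = true ∧ ev c.1 = 1 := by
  unfold derivable at h
  simp only [Bool.and_eq_true, decide_eq_true_eq] at h
  obtain ⟨⟨⟨⟨h1, h2⟩, h3⟩, h4⟩, h5⟩ := h
  refine ⟨h1, ?_⟩
  rw [← ev_eq_of_canon h2 h1 h4, full_eq L hL, canon_sound _ (okWord_spec h3), h5]
  simp [ev_nil, evT]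

/-- Add all derivable relators to the list. -/
def derive : List (List ℕ × List (List ℕ × ℕ × Bool) × List ℕ) → List (List ℕ) → List (List ℕ)
  | [], L => L
  | c :: cs, L => derive cs (bif derivable L c then L ++ [c.1] else L)

theorem derive_valid : ∀ (cs : List (List ℕ × List (List ℕ × ℕ × Bool) × List ℕ))
    (L : List (List ℕ)), ValidRels L → ValidRels (derive cs L)
  | [], _, hL => hL
  | c :: cs, L, hL => by
    unfold derive
    apply derive_valid cs
    cases h : derivable L c with
    | false => exact hL
    | true =>
      intro w hw
      rw [cond_true, List.mem_append, List.mem_singleton] at hw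
      rcases hw with hw | rfl
      · exact hL w hw
      · exact derivable_sound L hL c h

def baseRels : List (List ℕ) :=
  [[2, 4, 2, 4, 2, 4, 2, 4, 2, 4],
   [0, 2, 0, 0, 3, 0, 2, 0, 0, 3, 0, 2, 0, 0, 3, 0, 2, 0, 0, 3, 0, 2, 0, 0, 3]]

theorem baseRels_valid : ValidRels baseRels := by
  intro w hw
  simp only [baseRels, List.mem_cons, List.not_mem_nil, or_false] at hw
  rcases hw with rfl | rfl
  · exact ⟨rfl, by simpa [ev, letter, pow_succ, mul_assoc] using hr5⟩
  · exact ⟨rfl, by simpa [ev, letter, pow_succ, mul_assoc] using hr5'⟩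

/-- Index of `sᵢ₊ₖ` among `0, …, 6`, as letters of its two factors. -/
def sWord (i : ℕ) : List ℕ := [i % 7 + 3, i % 7 + 10]

/-- The translates under `x` of the relators `s₇² = 1` and `s₆ s₄ s₇ = 1`. -/
def shiftCerts : List (List ℕ × List (List ℕ × ℕ × Bool) × List ℕ) :=
  (List.range 7).map (fun k => (sWord k ++ sWord k,
    [(List.replicate (k + 1) 1, 7, true)], List.replicate (k + 1) 0)) ++
  (List.range 7).map (fun k => (sWord k ++ (sWord (k + 5) ++ sWord (k + 1)),
    [(List.replicate (k + 2) 1, 8, true)], List.replicate (k + 2) 0))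

def finalRels : List (List ℕ) := derive (relCerts ++ shiftCerts) baseRels

theorem finalRels_valid : ValidRels finalRels := derive_valid _ _ baseRels_valid

def finalCheck : Bool :=
  (List.range 7).all fun k => decide ((sWord k ++ sWord k) ∈ finalRels) &&
    decide ((sWord k ++ (sWord (k + 5) ++ sWord (k + 1))) ∈ finalRels)

theorem finalCheck_true : finalCheck = true := by decide +kernel

/-! ### Part 7: the theorem -/

theorem ev_sWord (k : ℕ) : ev (sWord k) = s (k % 7 + 1) := by
  simp [sWord, ev, letter, s]

theorem s_rels (k : ℕ) (hk : k < 7) :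
    s (k % 7 + 1) * s (k % 7 + 1) = 1 ∧
    s (k % 7 + 1) * (s ((k + 5) % 7 + 1) * s ((k + 1) % 7 + 1)) = 1 := by
  have h := finalCheck_true
  unfold finalCheck at h
  rw [List.all_eq_true] at h
  have h1 := h k (List.mem_range.mpr hk)
  rw [Bool.and_eq_true, decide_eq_true_eq, decide_eq_true_eq] at h1
  have h2 := (finalRels_valid _ h1.1).2
  have h3 := (finalRels_valid _ h1.2).2
  simp only [ev_append, ev_sWord] at h2 h3
  exact ⟨h2, h3⟩

theorem line_comm {a b c : G} (ha : a * a = 1) (hb : b * b = 1) (hc : c * c = 1)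
    (h : a * (b * c) = 1) : Commute a b ∧ Commute b c ∧ Commute a c := by
  have ia : a⁻¹ = a := inv_eq_of_mul_eq_one_left ha
  have ib : b⁻¹ = b := inv_eq_of_mul_eq_one_left hb
  have ic : c⁻¹ = c := inv_eq_of_mul_eq_one_left hc
  have hbc : b * c = a := by rw [← ia]; exact (inv_eq_of_mul_eq_one_right h).symm
  have hcb : c * b = a := by
    have := congrArg (fun z => z⁻¹) hbc
    simpa [ia, ib, ic] using this
  have h2 : Commute b c := by rw [Commute, SemiconjBy, hbc, hcb]
  refine ⟨?_, h2, ?_⟩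
  · rw [← hbc]; exact (Commute.refl b).mul_left h2.symm
  · rw [← hbc]; exact h2.mul_left (Commute.refl c)

theorem s_sq (i : ℕ) (h1 : 1 ≤ i) (h7 : i ≤ 7) : s i * s i = 1 := by
  have h := (s_rels (i - 1) (by omega)).1
  have e : (i - 1) % 7 + 1 = i := by omega
  rwa [e] at h

theorem s_comm_pair (i j : ℕ) (hi1 : 1 ≤ i) (hi7 : i ≤ 7) (hj1 : 1 ≤ j) (hj7 : j ≤ 7) :
    Commute (s i) (s j) := by
  have L : ∀ k, k < 7 → Commute (s (k % 7 + 1)) (s ((k + 5) % 7 + 1)) ∧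
      Commute (s ((k + 5) % 7 + 1)) (s ((k + 1) % 7 + 1)) ∧
      Commute (s (k % 7 + 1)) (s ((k + 1) % 7 + 1)) := by
    intro k hk
    have hlt : ∀ m, m % 7 + 1 ≤ 7 := fun m => by omega
    exact line_comm (s_sq _ (by omega) (hlt _)) (s_sq _ (by omega) (hlt _))
      (s_sq _ (by omega) (hlt _)) (s_rels k hk).2
  have hd : ∀ i j : ℕ, 1 ≤ i → i ≤ 7 → 1 ≤ j → j ≤ 7 →
      ((i + 7 - j) % 7 = 1 ∨ (i + 7 - j) % 7 = 2 ∨ (i + 7 - j) % 7 = 4) →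
      Commute (s i) (s j) := by
    intro i j h1 h2 h3 h4 h
    rcases h with h | h | h
    · have := (L (j - 1) (by omega)).2.2.symm
      have e1 : (j - 1) % 7 + 1 = j := by omega
      have e2 : (j - 1 + 1) % 7 + 1 = i := by omega
      rwa [e1, e2] at this
    · have := (L (i - 1) (by omega)).1
      have e1 : (i - 1) % 7 + 1 = i := by omega
      have e2 : (i - 1 + 5) % 7 + 1 = j := by omega
      rwa [e1, e2] at this
    · have := (L ((j + 5) % 7) (by omega)).2.1
      have e1 : ((j + 5) % 7 + 5) % 7 + 1 = i := by omega
      have e2 : ((j + 5) % 7 + 1) % 7 + 1 = j := by omega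
      rwa [e1, e2] at this
  by_cases hij : i = j
  · rw [hij]
  · by_cases h : (i + 7 - j) % 7 = 1 ∨ (i + 7 - j) % 7 = 2 ∨ (i + 7 - j) % 7 = 4
    · exact hd i j hi1 hi7 hj1 hj7 h
    · exact (hd j i hj1 hj7 hi1 hi7 (by omega)).symm

/-- The elements `s₁, …, s₇` pairwise commute; in particular the subgroup they
generate is commutative and every element of it has order dividing `2`. -/
theorem s_commute :
    (∀ i ∈ Finset.Icc 1 7, ∀ j ∈ Finset.Icc 1 7, s i * s j = s j * s i) ∧
    (∀ g ∈ Subgroup.closure (s '' Set.Icc 1 7),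
      (∀ h ∈ Subgroup.closure (s '' Set.Icc 1 7), g * h = h * g) ∧
        g ^ 2 = 1) := by
  have hc : ∀ g ∈ Subgroup.closure (s '' Set.Icc 1 7),
      ∀ h ∈ Subgroup.closure (s '' Set.Icc 1 7), g * h = h * g := by
    intro g hg h hh
    have hcc : ∀ a ∈ s '' Set.Icc 1 7, ∀ b ∈ s '' Set.Icc 1 7, a * b = b * a := by
      rintro _ ⟨i, hi, rfl⟩ _ ⟨j, hj, rfl⟩
      exact s_comm_pair i j hi.1 hi.2 hj.1 hj.2
    induction hg, hh using Subgroup.closure_induction₂ with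
    | mem a b ha hb => exact hcc a ha b hb
    | one_left b _ => simp
    | one_right a _ => simp
    | mul_left a b c _ _ _ h1 h2 => exact Commute.mul_left h1 h2
    | mul_right a b c _ _ _ h1 h2 => exact Commute.mul_right h1 h2
    | inv_left a b _ _ h1 => exact Commute.inv_left h1
    | inv_right a b _ _ h1 => exact Commute.inv_right h1
  refine ⟨?_, ?_⟩
  · intro i hi j hj
    rw [Finset.mem_Icc] at hi hj
    exact s_comm_pair i j hi.1 hi.2 hj.1 hj.2
  · intro g hg
    refine ⟨hc g hg, ?_⟩
    induction hg using Subgroup.closure_induction with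
    | mem a ha =>
      obtain ⟨i, hi, rfl⟩ := ha
      rw [pow_two]; exact s_sq i hi.1 hi.2
    | one => simp
    | mul a b ha hb h1 h2 => rw [Commute.mul_pow (hc a ha b hb), h1, h2, one_mul]
    | inv a _ h1 => rw [inv_pow, h1, inv_one]


end M22
end
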